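/- arXiv:1211.1001 — 2 statements merged into one kernel-verified Lean document; each statement's English description precedes it below -/
import Mathlib

section
/- (Borell's functional inequality, Theorem 4.1) Let 0 < ρ < 1 and let (G₁, G₂) be jointly Gaussian random vectors in ℝ^d × ℝ^d with mean zero and covariance given in block form by (I_d, ρI_d; ρI_d, I_d) (i.e., G₁ and G₂ are standard Gaussian vectors on ℝ^d with Cov((G₁)_i, (G₂)_j) = ρ·δ_{ij}). Then for all measurable f₁, f₂ : ℝ^d → [0,1], E[J_ρ(f₁(G₁), f₂(G₂))] ≤ J_ρ(E f₁(G₁), E f₂(G₂)). -/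
open MeasureTheory

noncomputable section
namespace DMN

/-- The standard normal CDF `Φ`. -/
def Phi (t : ℝ) : ℝ := ∫ s in Set.Iic t, Real.exp (-s ^ 2 / 2) / Real.sqrt (2 * Real.pi)

/-- The inverse of the standard normal CDF. -/
def PhiInv : ℝ → ℝ := Function.invFun Phi

/-- `J_ρ(x,y) = P[X ≤ Φ⁻¹(x), Y ≤ Φ⁻¹(y)]` for a centered bivariate Gaussian `(X,Y)`
with unit variances and covariance `ρ`, extended continuously to the boundary of
`[0,1]²`. -/
def J (ρ x y : ℝ) : ℝ :=
  if x = 0 ∨ y = 0 then 0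
  else if x = 1 then y
  else if y = 1 then x
  else
    ∫ s in Set.Iic (PhiInv x), ∫ t in Set.Iic (PhiInv y),
      Real.exp (-(s ^ 2 - 2 * ρ * s * t + t ^ 2) / (2 * (1 - ρ ^ 2))) /
        (2 * Real.pi * Real.sqrt (1 - ρ ^ 2))

/-- The bivariate Gaussian density with unit variances and correlation `ρ`. -/
def biGaussianDensity (ρ : ℝ) (p : ℝ × ℝ) : ℝ :=
  Real.exp (-(p.1 ^ 2 - 2 * ρ * p.1 * p.2 + p.2 ^ 2) / (2 * (1 - ρ ^ 2))) /
    (2 * Real.pi * Real.sqrt (1 - ρ ^ 2))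

/-- The centered bivariate Gaussian measure on `ℝ²` with unit variances and
correlation `ρ`. -/
def biGaussian (ρ : ℝ) : Measure (ℝ × ℝ) :=
  (volume : Measure (ℝ × ℝ)).withDensity fun p => ENNReal.ofReal (biGaussianDensity ρ p)

section

open Set Filter Topology ProbabilityTheory

variable {ρ : ℝ}

/-- The standard normal density. -/
def phi (t : ℝ) : ℝ := gaussianPDFReal 0 1 t

/-- The standard Gaussian measure on the line. -/
abbrev gam : Measure ℝ := gaussianReal 0 1

lemma phi_eq (t : ℝ) : phi t = Real.exp (-t ^ 2 / 2) / Real.sqrt (2 * Real.pi) := by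
  simp [phi, gaussianPDFReal, div_eq_mul_inv, mul_comm]

lemma phi_pos (t : ℝ) : 0 < phi t := gaussianPDFReal_pos 0 1 t one_ne_zero

lemma contDiff_phi : ContDiff ℝ ⊤ phi := by
  have : phi = fun t => Real.exp (-t ^ 2 / 2) / Real.sqrt (2 * Real.pi) := funext phi_eq
  rw [this]
  fun_prop

lemma Phi_eq (t : ℝ) : Phi t = ∫ s in Iic t, phi s := by simp only [Phi, phi_eq]

lemma gam_real_eq (s : Set ℝ) : gam.real s = ∫ x in s, phi x := by
  rw [Measure.real, gaussianReal_apply_eq_integral 0 one_ne_zero]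
  exact ENNReal.toReal_ofReal (integral_nonneg fun x => (phi_pos x).le)

lemma Phi_eq_gam (t : ℝ) : Phi t = gam.real (Iic t) := by rw [Phi_eq, gam_real_eq]

lemma hasDerivAt_Phi (t : ℝ) : HasDerivAt Phi (phi t) t := by
  have hint : Integrable phi := integrable_gaussianPDFReal 0 1
  have h : Phi = fun u => Phi 0 + ∫ s in (0 : ℝ)..u, phi s := by
    funext u
    rw [Phi_eq, Phi_eq, ← intervalIntegral.integral_Iic_sub_Iic hint.integrableOn hint.integrableOn]
    ring
  rw [h]
  exact (intervalIntegral.integral_hasDerivAt_right hint.intervalIntegrable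
    (contDiff_phi.continuous.stronglyMeasurableAtFilter _ _)
    contDiff_phi.continuous.continuousAt).const_add _

lemma strictMono_Phi : StrictMono Phi :=
  strictMono_of_deriv_pos fun x => by rw [(hasDerivAt_Phi x).deriv]; exact phi_pos x

lemma continuous_Phi : Continuous Phi :=
  continuous_iff_continuousAt.2 fun x => (hasDerivAt_Phi x).continuousAt

lemma contDiff_Phi : ContDiff ℝ 3 Phi := by
  have h : deriv Phi = phi := funext fun x => (hasDerivAt_Phi x).deriv
  rw [show (3 : WithTop ℕ∞) = 2 + 1 by norm_num, contDiff_succ_iff_deriv]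
  refine ⟨fun x => (hasDerivAt_Phi x).differentiableAt, by simp, ?_⟩
  rw [h]
  exact contDiff_phi.of_le le_top

lemma tendsto_Phi_atTop : Tendsto Phi atTop (𝓝 1) := by
  have := tendsto_cdf_atTop gam
  refine this.congr fun x => ?_
  rw [cdf_eq_real, Phi_eq_gam]

lemma tendsto_Phi_atBot : Tendsto Phi atBot (𝓝 0) := by
  have := tendsto_cdf_atBot gam
  refine this.congr fun x => ?_
  rw [cdf_eq_real, Phi_eq_gam]

lemma Phi_pos (t : ℝ) : 0 < Phi t :=
  (le_of_tendsto tendsto_Phi_atBot (by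
    filter_upwards [eventually_le_atBot (t - 1)] with x hx
      using strictMono_Phi.monotone hx)).trans_lt (strictMono_Phi (sub_one_lt t))

lemma Phi_lt_one (t : ℝ) : Phi t < 1 :=
  (strictMono_Phi (lt_add_one t)).trans_le (ge_of_tendsto tendsto_Phi_atTop (by
    filter_upwards [eventually_ge_atTop (t + 1)] with x hx using strictMono_Phi.monotone hx))

lemma PhiInv_Phi (t : ℝ) : PhiInv (Phi t) = t :=
  Function.leftInverse_invFun strictMono_Phi.injective t

lemma Phi_PhiInv {x : ℝ} (hx : x ∈ Ioo (0 : ℝ) 1) : Phi (PhiInv x) = x := by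
  refine Function.invFun_eq ?_
  have : x ∈ Phi '' univ := by
    obtain ⟨a, ha⟩ := ((tendsto_Phi_atBot.eventually_lt_const hx.1)).exists
    obtain ⟨b, hb⟩ := ((tendsto_Phi_atTop.eventually_const_lt hx.2)).exists
    obtain ⟨c, hc⟩ := mem_range_of_exists_le_of_exists_ge continuous_Phi ⟨a, ha.le⟩ ⟨b, hb.le⟩
    exact ⟨c, trivial, hc⟩
  simpa using this

lemma contDiffAt_PhiInv {x : ℝ} (hx : x ∈ Ioo (0 : ℝ) 1) : ContDiffAt ℝ 3 PhiInv x := by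
  have hd := hasDerivAt_Phi (PhiInv x)
  have hne := (phi_pos (PhiInv x)).ne'
  have hc : ContDiffAt ℝ 3 Phi (PhiInv x) := contDiff_Phi.contDiffAt
  let e : ℝ ≃L[ℝ] ℝ := ContinuousLinearEquiv.unitsEquivAut ℝ (Units.mk0 _ hne)
  have hd' : HasFDerivAt Phi (e : ℝ →L[ℝ] ℝ) (PhiInv x) := by
    refine hd.hasFDerivAt.congr_fderiv ?_
    ext
    simp [e]
  have hloc := hc.to_localInverse hd' (by norm_num)
  have hstrict : HasStrictFDerivAt Phi (e : ℝ →L[ℝ] ℝ) (PhiInv x) :=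
    hc.hasStrictFDerivAt' hd' (by norm_num)
  have hev := hstrict.eventually_right_inverse
  rw [Phi_PhiInv hx] at hloc hev
  refine hloc.congr_of_eventuallyEq ?_
  filter_upwards [hev] with y hy
  conv_lhs => rw [← hy]
  rw [PhiInv_Phi]
  rfl

lemma hasDerivAt_PhiInv {x : ℝ} (hx : x ∈ Ioo (0 : ℝ) 1) :
    HasDerivAt PhiInv (phi (PhiInv x))⁻¹ x := by
  refine HasDerivAt.of_local_left_inverse (contDiffAt_PhiInv hx).continuousAt
    (hasDerivAt_Phi _) (phi_pos _).ne' ?_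
  filter_upwards [Ioo_mem_nhds hx.1 hx.2] with y hy using Phi_PhiInv hy

/-- The standard deviation of one coordinate given the other. -/
def sig (ρ : ℝ) : ℝ := Real.sqrt (1 - ρ ^ 2)


lemma one_sub_sq_pos (h0 : 0 < ρ) (h1 : ρ < 1) : 0 < 1 - ρ ^ 2 := by nlinarith

lemma sig_pos (h0 : 0 < ρ) (h1 : ρ < 1) : 0 < sig ρ := Real.sqrt_pos.2 (one_sub_sq_pos h0 h1)

lemma sig_sq (h0 : 0 < ρ) (h1 : ρ < 1) : sig ρ ^ 2 = 1 - ρ ^ 2 :=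
  Real.sq_sqrt (one_sub_sq_pos h0 h1).le

/-- The conditional variance as a nonnegative real. -/
def sigSq (ρ : ℝ) : NNReal := (sig ρ ^ 2).toNNReal

lemma coe_sigSq : (sigSq ρ : ℝ) = sig ρ ^ 2 := Real.coe_toNNReal _ (sq_nonneg _)

lemma sigSq_ne_zero (h0 : 0 < ρ) (h1 : ρ < 1) : sigSq ρ ≠ 0 := by
  intro h
  have : sig ρ ^ 2 = 0 := by rw [← coe_sigSq, h, NNReal.coe_zero]
  exact (pow_pos (sig_pos h0 h1) 2).ne' this

lemma biGaussianDensity_eq (h0 : 0 < ρ) (h1 : ρ < 1) (s t : ℝ) :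
    biGaussianDensity ρ (s, t) = phi s * gaussianPDFReal (ρ * s) (sigSq ρ) t := by
  have hs := sig_sq h0 h1
  have hσ := sig_pos h0 h1
  have hp : 0 < 1 - ρ ^ 2 := one_sub_sq_pos h0 h1
  have hpi : Real.sqrt (2 * Real.pi) ^ 2 = 2 * Real.pi := Real.sq_sqrt (by positivity)
  have h2 : Real.sqrt (2 * Real.pi * sig ρ ^ 2) = Real.sqrt (2 * Real.pi) * sig ρ := by
    rw [Real.sqrt_mul (by positivity), Real.sqrt_sq hσ.le]
  have hq : 0 < Real.sqrt (2 * Real.pi) := by positivity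
  simp only [biGaussianDensity, phi_eq, gaussianPDFReal, coe_sigSq]
  rw [h2, hs, show Real.sqrt (1 - ρ ^ 2) = sig ρ from rfl]
  rw [show Real.exp (-s ^ 2 / 2) / √(2 * Real.pi) *
      ((√(2 * Real.pi) * sig ρ)⁻¹ * Real.exp (-(t - ρ * s) ^ 2 / (2 * (1 - ρ ^ 2)))) =
      (Real.exp (-s ^ 2 / 2) * Real.exp (-(t - ρ * s) ^ 2 / (2 * (1 - ρ ^ 2)))) /
      (√(2 * Real.pi) ^ 2 * sig ρ) by field_simp, hpi, ← Real.exp_add]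
  congr 2
  field_simp
  ring

/-- The linear map turning two independent standard Gaussians into a `ρ`-correlated pair. -/
def corrMap (ρ : ℝ) : ℝ × ℝ →L[ℝ] ℝ × ℝ :=
  (ContinuousLinearMap.fst ℝ ℝ ℝ).prod
    (ρ • ContinuousLinearMap.fst ℝ ℝ ℝ + sig ρ • ContinuousLinearMap.snd ℝ ℝ ℝ)

@[simp] lemma corrMap_apply (p : ℝ × ℝ) : corrMap ρ p = (p.1, ρ * p.1 + sig ρ * p.2) := rfl

lemma gam_map_affine (a : ℝ) : gam.map (fun t => a + sig ρ * t) = gaussianReal a (sigSq ρ) := by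
  have h1 := gaussianReal_map_const_mul (μ := 0) (v := 1) (sig ρ)
  have h2 := gaussianReal_map_const_add (μ := sig ρ * 0) (v := sigSq ρ) a
  rw [show sigSq ρ = .mk (sig ρ ^ 2) (sq_nonneg _) * 1 by
    rw [mul_one]; exact NNReal.eq coe_sigSq] at h2 ⊢
  rw [← h1, Measure.map_map (by fun_prop) (by fun_prop)] at h2
  simpa [Function.comp_def] using h2

lemma measurable_biGaussianDensity : Measurable (biGaussianDensity ρ) := by
  unfold biGaussianDensity
  fun_prop

lemma biGaussian_eq_map (h0 : 0 < ρ) (h1 : ρ < 1) :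
    biGaussian ρ = (gam.prod gam).map (corrMap ρ) := by
  refine Measure.ext_of_lintegral _ fun f hf => ?_
  rw [biGaussian, lintegral_withDensity_eq_lintegral_mul _
    measurable_biGaussianDensity.ennreal_ofReal hf, lintegral_map hf (by fun_prop),
    Measure.volume_eq_prod, lintegral_prod _ (by
      exact (measurable_biGaussianDensity.ennreal_ofReal.mul hf).aemeasurable),
    lintegral_prod _ (by fun_prop)]
  have hmeas : Measurable fun s => ∫⁻ t, f (corrMap ρ (s, t)) ∂gam := by
    have : Measurable fun p : ℝ × ℝ => f (corrMap ρ p) := by fun_prop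
    exact this.lintegral_prod_right'
  have hgam : (gam : Measure ℝ) = volume.withDensity (gaussianPDF 0 1) :=
    gaussianReal_of_var_ne_zero 0 one_ne_zero
  have houter : ∫⁻ s, ∫⁻ t, f (corrMap ρ (s, t)) ∂gam ∂gam
      = ∫⁻ s, gaussianPDF 0 1 s * ∫⁻ t, f (corrMap ρ (s, t)) ∂gam := by
    conv_lhs => enter [1]; rw [hgam]
    rw [lintegral_withDensity_eq_lintegral_mul _ (measurable_gaussianPDF 0 1) hmeas]
    rfl
  rw [houter]
  refine lintegral_congr fun s => ?_
  have hin : ∫⁻ t, f (corrMap ρ (s, t)) ∂gam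
      = ∫⁻ t, gaussianPDF (ρ * s) (sigSq ρ) t * f (s, t) := by
    have hfs : Measurable fun t => f (s, t) := by fun_prop
    have h : ∫⁻ t, f (corrMap ρ (s, t)) ∂gam = ∫⁻ t, f (s, t) ∂(gaussianReal (ρ * s) (sigSq ρ)) := by
      rw [← gam_map_affine, lintegral_map hfs (by fun_prop)]
      rfl
    rw [h, gaussianReal_of_var_ne_zero _ (sigSq_ne_zero h0 h1),
      lintegral_withDensity_eq_lintegral_mul _ (measurable_gaussianPDF _ _) hfs]
    rfl
  simp only [Pi.mul_apply]
  rw [hin, ← lintegral_const_mul _ (by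
    exact (measurable_gaussianPDF _ _).mul (by fun_prop))]
  refine lintegral_congr fun t => ?_
  rw [biGaussianDensity_eq h0 h1, ENNReal.ofReal_mul (phi_pos s).le, mul_assoc]
  rfl

lemma isGaussian_biGaussian (h0 : 0 < ρ) (h1 : ρ < 1) : IsGaussian (biGaussian ρ) := by
  rw [biGaussian_eq_map h0 h1]
  infer_instance

lemma isProbabilityMeasure_biGaussian (h0 : 0 < ρ) (h1 : ρ < 1) :
    IsProbabilityMeasure (biGaussian ρ) :=
  have := isGaussian_biGaussian h0 h1
  inferInstance

lemma integral_sq_gam : ∫ s, s ^ 2 ∂gam = 1 := by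
  have h := variance_id_gaussianReal (μ := 0) (v := 1)
  rw [variance_of_integral_eq_zero (by fun_prop) (by simp)] at h
  simpa using h

lemma integral_id_gam : ∫ s, s ∂gam = 0 := integral_id_gaussianReal

lemma integrable_id_gam : Integrable (fun s : ℝ => s) gam :=
  IsGaussian.integrable_id (μ := gam)

lemma integrable_sq_gam : Integrable (fun s : ℝ => s ^ 2) gam :=
  (IsGaussian.memLp_two_id (μ := gam)).integrable_sq

lemma integral_biGaussian (h0 : 0 < ρ) (h1 : ρ < 1) {f : ℝ × ℝ → ℝ} (hf : Continuous f) :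
    ∫ p, f p ∂(biGaussian ρ) = ∫ p : ℝ × ℝ, f (p.1, ρ * p.1 + sig ρ * p.2) ∂(gam.prod gam) := by
  rw [biGaussian_eq_map h0 h1, integral_map (by fun_prop) hf.aestronglyMeasurable]
  rfl

lemma integral_prod_sq_fst : ∫ p : ℝ × ℝ, p.1 ^ 2 ∂(gam.prod gam) = 1 := by
  rw [← integral_sq_gam]
  simpa using integral_fun_fst (μ := gam) (ν := gam) (fun s : ℝ => s ^ 2)

lemma integral_prod_sq_snd : ∫ p : ℝ × ℝ, p.2 ^ 2 ∂(gam.prod gam) = 1 := by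
  rw [← integral_sq_gam]
  simpa using integral_fun_snd (μ := gam) (ν := gam) (fun s : ℝ => s ^ 2)

lemma integral_prod_fst_mul_snd : ∫ p : ℝ × ℝ, p.1 * p.2 ∂(gam.prod gam) = 0 := by
  simpa [integral_id_gam] using integral_prod_mul (μ := gam) (ν := gam) (fun s : ℝ => s) (fun s : ℝ => s)

lemma integrable_prod_sq_fst : Integrable (fun p : ℝ × ℝ => p.1 ^ 2) (gam.prod gam) :=
  integrable_sq_gam.comp_fst gam

lemma integrable_prod_sq_snd : Integrable (fun p : ℝ × ℝ => p.2 ^ 2) (gam.prod gam) :=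
  integrable_sq_gam.comp_snd gam

lemma integrable_prod_fst_mul_snd : Integrable (fun p : ℝ × ℝ => p.1 * p.2) (gam.prod gam) :=
  integrable_id_gam.mul_prod integrable_id_gam

lemma biGaussian_sq_fst (h0 : 0 < ρ) (h1 : ρ < 1) : ∫ p, p.1 ^ 2 ∂(biGaussian ρ) = 1 := by
  rw [integral_biGaussian h0 h1 (by fun_prop)]
  exact integral_prod_sq_fst

lemma biGaussian_fst_mul_snd (h0 : 0 < ρ) (h1 : ρ < 1) :
    ∫ p, p.1 * p.2 ∂(biGaussian ρ) = ρ := by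
  rw [integral_biGaussian h0 h1 (by fun_prop)]
  have : ∀ p : ℝ × ℝ, p.1 * (ρ * p.1 + sig ρ * p.2) = ρ * p.1 ^ 2 + sig ρ * (p.1 * p.2) :=
    fun p => by ring
  simp only [this]
  rw [integral_add (integrable_prod_sq_fst.const_mul _)
    (integrable_prod_fst_mul_snd.const_mul _), integral_const_mul, integral_const_mul,
    integral_prod_sq_fst, integral_prod_fst_mul_snd]
  ring

lemma biGaussian_sq_snd (h0 : 0 < ρ) (h1 : ρ < 1) : ∫ p, p.2 ^ 2 ∂(biGaussian ρ) = 1 := by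
  rw [integral_biGaussian h0 h1 (by fun_prop)]
  have : ∀ p : ℝ × ℝ, (ρ * p.1 + sig ρ * p.2) ^ 2
      = ρ ^ 2 * p.1 ^ 2 + 2 * ρ * sig ρ * (p.1 * p.2) + sig ρ ^ 2 * p.2 ^ 2 := fun p => by ring
  simp only [this]
  rw [integral_add (((integrable_prod_sq_fst).const_mul (ρ ^ 2)).fun_add
    (integrable_prod_fst_mul_snd.const_mul (2 * ρ * sig ρ))) (integrable_prod_sq_snd.const_mul _),
    integral_add (integrable_prod_sq_fst.const_mul _)
    (integrable_prod_fst_mul_snd.const_mul _), integral_const_mul, integral_const_mul,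
    integral_const_mul, integral_prod_sq_fst, integral_prod_fst_mul_snd, integral_prod_sq_snd,
    sig_sq h0 h1]
  ring

lemma biGaussian_integral_id (h0 : 0 < ρ) (h1 : ρ < 1) : (biGaussian ρ)[id] = 0 := by
  have := isGaussian_biGaussian h0 h1
  have hi : Integrable (id : ℝ × ℝ → ℝ × ℝ) (biGaussian ρ) := IsGaussian.integrable_id
  have hf : ∫ p : ℝ × ℝ, p.1 ∂(gam.prod gam) = 0 := by
    rw [← integral_id_gam]
    simpa using integral_fun_fst (μ := gam) (ν := gam) (fun s : ℝ => s)
  have hs : ∫ p : ℝ × ℝ, p.2 ∂(gam.prod gam) = 0 := by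
    rw [← integral_id_gam]
    simpa using integral_fun_snd (μ := gam) (ν := gam) (fun s : ℝ => s)
  refine Prod.ext ?_ ?_
  · rw [fst_integral hi]
    simp only [id, Prod.fst_zero]
    rw [integral_biGaussian h0 h1 (by fun_prop)]
    exact hf
  · rw [snd_integral hi]
    simp only [id, Prod.snd_zero]
    rw [integral_biGaussian h0 h1 (by fun_prop), integral_add
      ((integrable_id_gam.comp_fst gam).const_mul _) ((integrable_id_gam.comp_snd gam).const_mul _),
      integral_const_mul, integral_const_mul, hf, hs]
    ring

lemma biGaussian_integral_fst (h0 : 0 < ρ) (h1 : ρ < 1) : ∫ p, p.1 ∂(biGaussian ρ) = 0 := by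
  have := isGaussian_biGaussian h0 h1
  have h := congrArg Prod.fst (biGaussian_integral_id h0 h1)
  rwa [fst_integral IsGaussian.integrable_id] at h

lemma biGaussian_integral_snd (h0 : 0 < ρ) (h1 : ρ < 1) : ∫ p, p.2 ∂(biGaussian ρ) = 0 := by
  have := isGaussian_biGaussian h0 h1
  have h := congrArg Prod.snd (biGaussian_integral_id h0 h1)
  rwa [snd_integral IsGaussian.integrable_id] at h

lemma map_fst_biGaussian (h0 : 0 < ρ) (h1 : ρ < 1) : (biGaussian ρ).map Prod.fst = gam := by
  rw [biGaussian_eq_map h0 h1, Measure.map_map (by fun_prop) (by fun_prop)]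
  exact Measure.fst_prod

lemma map_snd_biGaussian (h0 : 0 < ρ) (h1 : ρ < 1) : (biGaussian ρ).map Prod.snd = gam := by
  have := isGaussian_biGaussian h0 h1
  have hG : IsGaussian ((biGaussian ρ).map Prod.snd) :=
    isGaussian_map (ContinuousLinearMap.snd ℝ ℝ ℝ)
  have hm : ∫ x, x ∂((biGaussian ρ).map Prod.snd) = 0 := by
    rw [integral_map (by fun_prop) (by fun_prop)]
    exact biGaussian_integral_snd h0 h1
  have hv : Var[id; (biGaussian ρ).map Prod.snd] = 1 := by
    rw [variance_of_integral_eq_zero (by fun_prop) (by simpa using hm),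
      integral_map (by fun_prop) (by fun_prop)]
    exact biGaussian_sq_snd h0 h1
  have h := IsGaussian.eq_gaussianReal _ hG
  rw [h]
  simp only [id] at hv ⊢
  rw [hm]
  simp [hv]

/-- A rotation of two independent correlated pairs has a correlated pair as first component. -/
lemma biGaussian_map_rotation (h0 : 0 < ρ) (h1 : ρ < 1) (θ : ℝ) :
    ((biGaussian ρ).prod (biGaussian ρ)).map
      (fun q : (ℝ × ℝ) × (ℝ × ℝ) => Real.cos θ • q.1 + Real.sin θ • q.2) = biGaussian ρ := by
  have := isGaussian_biGaussian h0 h1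
  have h := IsGaussian.map_rotation_eq_self (biGaussian_integral_id h0 h1) θ
  have h' := congrArg (Measure.map Prod.fst) h
  rw [Measure.map_map (by fun_prop) (by fun_prop)] at h'
  rw [show Measure.map Prod.fst ((biGaussian ρ).prod (biGaussian ρ)) = biGaussian ρ from
    Measure.fst_prod] at h'
  exact h'

/-- The half-line of Gaussian measure `x`. -/
def halfLine (x : ℝ) : Set ℝ := {s | Phi s ≤ x}

lemma measurableSet_halfLine (x : ℝ) : MeasurableSet (halfLine x) :=
  measurableSet_le continuous_Phi.measurable measurable_const

lemma halfLine_mono {x y : ℝ} (h : x ≤ y) : halfLine x ⊆ halfLine y := fun _ hs => le_trans hs h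

lemma halfLine_zero : halfLine 0 = ∅ :=
  eq_empty_of_forall_notMem fun s hs => (Phi_pos s).not_ge hs

lemma halfLine_one : halfLine 1 = univ :=
  eq_univ_of_forall fun s => (Phi_lt_one s).le

lemma halfLine_of_mem_Ioo {x : ℝ} (hx : x ∈ Ioo (0 : ℝ) 1) : halfLine x = Iic (PhiInv x) := by
  ext s
  conv_lhs => rw [halfLine, mem_ofPred_eq, ← Phi_PhiInv hx, strictMono_Phi.le_iff_le]
  rfl

lemma mem_Icc_cases {x : ℝ} (hx : x ∈ Icc (0 : ℝ) 1) : x = 0 ∨ x = 1 ∨ x ∈ Ioo (0 : ℝ) 1 := by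
  rcases hx.1.eq_or_lt with h | h
  · exact Or.inl h.symm
  · rcases hx.2.eq_or_lt with h' | h'
    · exact Or.inr (Or.inl h')
    · exact Or.inr (Or.inr ⟨h, h'⟩)

lemma gam_halfLine {x : ℝ} (hx : x ∈ Icc (0 : ℝ) 1) : gam.real (halfLine x) = x := by
  rcases mem_Icc_cases hx with rfl | rfl | h
  · simp [halfLine_zero]
  · simp [halfLine_one]
  · rw [halfLine_of_mem_Ioo h, ← Phi_eq_gam, Phi_PhiInv h]

lemma biGaussian_real_fst (h0 : 0 < ρ) (h1 : ρ < 1) {s : Set ℝ} (hs : MeasurableSet s) :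
    (biGaussian ρ).real (Prod.fst ⁻¹' s) = gam.real s := by
  rw [← map_fst_biGaussian h0 h1, map_measureReal_apply (by fun_prop) hs]

lemma biGaussian_real_snd (h0 : 0 < ρ) (h1 : ρ < 1) {s : Set ℝ} (hs : MeasurableSet s) :
    (biGaussian ρ).real (Prod.snd ⁻¹' s) = gam.real s := by
  rw [← map_snd_biGaussian h0 h1, map_measureReal_apply (by fun_prop) hs]

lemma biGaussianDensity_nonneg (h0 : 0 < ρ) (h1 : ρ < 1) (p : ℝ × ℝ) :
    0 ≤ biGaussianDensity ρ p := by
  obtain ⟨s, t⟩ := p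
  rw [biGaussianDensity_eq h0 h1]
  exact mul_nonneg (phi_pos s).le (gaussianPDFReal_nonneg _ _ _)

lemma integrable_biGaussianDensity (h0 : 0 < ρ) (h1 : ρ < 1) :
    Integrable (biGaussianDensity ρ) := by
  have := isProbabilityMeasure_biGaussian h0 h1
  refine ⟨measurable_biGaussianDensity.aestronglyMeasurable, ?_⟩
  rw [hasFiniteIntegral_iff_ofReal (ae_of_all _ (biGaussianDensity_nonneg h0 h1)),
    ← setLIntegral_univ, ← withDensity_apply _ MeasurableSet.univ]
  exact measure_lt_top (biGaussian ρ) univ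

lemma biGaussian_real_eq (h0 : 0 < ρ) (h1 : ρ < 1) {s : Set (ℝ × ℝ)} (hs : MeasurableSet s) :
    (biGaussian ρ).real s = ∫ p in s, biGaussianDensity ρ p := by
  rw [integral_eq_lintegral_of_nonneg_ae (ae_of_all _ (biGaussianDensity_nonneg h0 h1))
    measurable_biGaussianDensity.aestronglyMeasurable, Measure.real, biGaussian,
    withDensity_apply _ hs]

lemma J_eq_measure (h0 : 0 < ρ) (h1 : ρ < 1) {x y : ℝ} (hx : x ∈ Icc (0 : ℝ) 1)
    (hy : y ∈ Icc (0 : ℝ) 1) : J ρ x y = (biGaussian ρ).real (halfLine x ×ˢ halfLine y) := by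
  have := isProbabilityMeasure_biGaussian h0 h1
  rcases mem_Icc_cases hx with rfl | rfl | hx'
  · simp [J, halfLine_zero]
  · rw [halfLine_one, univ_prod, biGaussian_real_snd h0 h1 (measurableSet_halfLine _),
      gam_halfLine hy]
    by_cases h : y = 0 <;> simp [J, h]
  rcases mem_Icc_cases hy with rfl | rfl | hy'
  · simp [J, halfLine_zero]
  · rw [halfLine_one, prod_univ, biGaussian_real_fst h0 h1 (measurableSet_halfLine _),
      gam_halfLine hx]
    simp [J, hx'.1.ne', hx'.2.ne]
  rw [halfLine_of_mem_Ioo hx', halfLine_of_mem_Ioo hy', biGaussian_real_eq h0 h1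
    (measurableSet_Iic.prod measurableSet_Iic), Measure.volume_eq_prod,
    setIntegral_prod _ (integrable_biGaussianDensity h0 h1).integrableOn]
  simp [J, hx'.1.ne', hx'.2.ne, hy'.1.ne', hy'.2.ne, biGaussianDensity]

lemma biGaussian_real_swap (h0 : 0 < ρ) (h1 : ρ < 1) (x y : ℝ) :
    (biGaussian ρ).real (halfLine x ×ˢ halfLine y)
      = (biGaussian ρ).real (halfLine y ×ˢ halfLine x) := by
  rw [biGaussian_real_eq h0 h1 ((measurableSet_halfLine _).prod (measurableSet_halfLine _)),
    biGaussian_real_eq h0 h1 ((measurableSet_halfLine _).prod (measurableSet_halfLine _))]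
  have h := (Measure.measurePreserving_swap (μ := (volume : Measure ℝ))
    (ν := (volume : Measure ℝ))).setIntegral_preimage_emb
    MeasurableEquiv.prodComm.measurableEmbedding (biGaussianDensity ρ) (halfLine x ×ˢ halfLine y)
  rw [Measure.volume_eq_prod, ← h, preimage_swap_prod]
  refine integral_congr_ae (ae_of_all _ fun p => ?_)
  simp only [biGaussianDensity, Prod.fst_swap, Prod.snd_swap]
  congr 3
  ring

lemma J_comm (h0 : 0 < ρ) (h1 : ρ < 1) {x y : ℝ} (hx : x ∈ Icc (0 : ℝ) 1)
    (hy : y ∈ Icc (0 : ℝ) 1) : J ρ x y = J ρ y x := by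
  rw [J_eq_measure h0 h1 hx hy, J_eq_measure h0 h1 hy hx, biGaussian_real_swap h0 h1]

lemma J_nonneg (h0 : 0 < ρ) (h1 : ρ < 1) {x y : ℝ} (hx : x ∈ Icc (0 : ℝ) 1)
    (hy : y ∈ Icc (0 : ℝ) 1) : 0 ≤ J ρ x y := by
  rw [J_eq_measure h0 h1 hx hy]; exact measureReal_nonneg

lemma J_le_one (h0 : 0 < ρ) (h1 : ρ < 1) {x y : ℝ} (hx : x ∈ Icc (0 : ℝ) 1)
    (hy : y ∈ Icc (0 : ℝ) 1) : J ρ x y ≤ 1 := by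
  have := isProbabilityMeasure_biGaussian h0 h1
  rw [J_eq_measure h0 h1 hx hy]; exact measureReal_le_one

lemma J_le_add_fst (h0 : 0 < ρ) (h1 : ρ < 1) {x x' y : ℝ} (hx : x ∈ Icc (0 : ℝ) 1)
    (hx' : x' ∈ Icc (0 : ℝ) 1) (hy : y ∈ Icc (0 : ℝ) 1) : J ρ x' y ≤ J ρ x y + |x' - x| := by
  have := isProbabilityMeasure_biGaussian h0 h1
  rw [J_eq_measure h0 h1 hx hy, J_eq_measure h0 h1 hx' hy]
  rcases le_total x' x with h | h
  · have : (biGaussian ρ).real (halfLine x' ×ˢ halfLine y)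
        ≤ (biGaussian ρ).real (halfLine x ×ˢ halfLine y) :=
      measureReal_mono (prod_mono_left (halfLine_mono h))
    linarith [abs_nonneg (x' - x)]
  · have hd : (biGaussian ρ).real (Prod.fst ⁻¹' (halfLine x' \ halfLine x)) = x' - x := by
      rw [biGaussian_real_fst h0 h1 ((measurableSet_halfLine _).diff (measurableSet_halfLine _)),
        measureReal_sdiff (halfLine_mono h) (measurableSet_halfLine _), gam_halfLine hx,
        gam_halfLine hx']
    rw [abs_of_nonneg (sub_nonneg.2 h), ← hd]
    refine (measureReal_mono ?_).trans (measureReal_union_le _ _)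
    rintro ⟨s, t⟩ ⟨hs, ht⟩
    by_cases h' : s ∈ halfLine x
    · exact Or.inl ⟨h', ht⟩
    · exact Or.inr ⟨hs, h'⟩

lemma J_le_add (h0 : 0 < ρ) (h1 : ρ < 1) {x x' y y' : ℝ} (hx : x ∈ Icc (0 : ℝ) 1)
    (hx' : x' ∈ Icc (0 : ℝ) 1) (hy : y ∈ Icc (0 : ℝ) 1) (hy' : y' ∈ Icc (0 : ℝ) 1) :
    J ρ x' y' ≤ J ρ x y + (|x' - x| + |y' - y|) := by
  have h := J_le_add_fst h0 h1 hx hx' hy'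
  have h' := J_le_add_fst h0 h1 hy hy' hx
  rw [J_comm h0 h1 hy' hx, J_comm h0 h1 hy hx] at h'
  linarith

/-- A continuous extension of `J ρ` to the plane. -/
def Jext (ρ : ℝ) (p : ℝ × ℝ) : ℝ :=
  J ρ (projIcc (0 : ℝ) 1 zero_le_one p.1) (projIcc (0 : ℝ) 1 zero_le_one p.2)

lemma Jext_eq {x y : ℝ} (hx : x ∈ Icc (0 : ℝ) 1) (hy : y ∈ Icc (0 : ℝ) 1) :
    Jext ρ (x, y) = J ρ x y := by
  simp [Jext, projIcc_of_mem _ hx, projIcc_of_mem _ hy]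

lemma continuous_Jext (h0 : 0 < ρ) (h1 : ρ < 1) : Continuous (Jext ρ) := by
  have hJ : Continuous fun q : Icc (0 : ℝ) 1 × Icc (0 : ℝ) 1 => J ρ q.1 q.2 := by
    refine continuous_iff_continuousAt.2 fun q => ?_
    rw [ContinuousAt, tendsto_iff_dist_tendsto_zero]
    have hb : Tendsto (fun r : Icc (0 : ℝ) 1 × Icc (0 : ℝ) 1 =>
        |(r.1 : ℝ) - q.1| + |(r.2 : ℝ) - q.2|) (𝓝 q) (𝓝 0) := by
      have : Continuous fun r : Icc (0 : ℝ) 1 × Icc (0 : ℝ) 1 =>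
        |(r.1 : ℝ) - q.1| + |(r.2 : ℝ) - q.2| := by fun_prop
      simpa using this.tendsto q
    refine squeeze_zero (fun _ => dist_nonneg) (fun r => ?_) hb
    have e1 := J_le_add h0 h1 q.1.2 r.1.2 q.2.2 r.2.2
    have e2 := J_le_add h0 h1 r.1.2 q.1.2 r.2.2 q.2.2
    rw [abs_sub_comm (q.1 : ℝ), abs_sub_comm (q.2 : ℝ)] at e2
    rw [Real.dist_eq, abs_le]
    constructor <;> linarith
  have hp : Continuous fun p : ℝ × ℝ =>
    (projIcc (0 : ℝ) 1 zero_le_one p.1, projIcc (0 : ℝ) 1 zero_le_one p.2) :=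
    (continuous_projIcc.comp continuous_fst).prodMk (continuous_projIcc.comp continuous_snd)
  exact hJ.comp hp

lemma measurable_J_comp {Ω : Type*} [MeasurableSpace Ω] (h0 : 0 < ρ) (h1 : ρ < 1)
    {F G : Ω → ℝ} (hF : Measurable F) (hG : Measurable G) (hF' : ∀ z, F z ∈ Icc (0 : ℝ) 1)
    (hG' : ∀ z, G z ∈ Icc (0 : ℝ) 1) : Measurable fun z => J ρ (F z) (G z) := by
  have h : (fun z => J ρ (F z) (G z)) = fun z => Jext ρ (F z, G z) :=
    funext fun z => (Jext_eq (hF' z) (hG' z)).symm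
  rw [h]
  exact (continuous_Jext h0 h1).measurable.comp (hF.prodMk hG)

lemma integrable_of_mem_Icc {Ω : Type*} [MeasurableSpace Ω] {P : Measure Ω} [IsFiniteMeasure P]
    {F : Ω → ℝ} (hF : Measurable F) (hF' : ∀ z, F z ∈ Icc (0 : ℝ) 1) : Integrable F P :=
  Integrable.of_bound hF.aestronglyMeasurable 1 (ae_of_all _ fun z => by
    rw [Real.norm_eq_abs, abs_of_nonneg (hF' z).1]; exact (hF' z).2)

lemma integrable_J_comp {Ω : Type*} [MeasurableSpace Ω] {P : Measure Ω} [IsFiniteMeasure P]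
    (h0 : 0 < ρ) (h1 : ρ < 1)
    {F G : Ω → ℝ} (hF : Measurable F) (hG : Measurable G) (hF' : ∀ z, F z ∈ Icc (0 : ℝ) 1)
    (hG' : ∀ z, G z ∈ Icc (0 : ℝ) 1) : Integrable (fun z => J ρ (F z) (G z)) P :=
  integrable_of_mem_Icc (measurable_J_comp h0 h1 hF hG hF' hG')
    fun z => ⟨J_nonneg h0 h1 (hF' z) (hG' z), J_le_one h0 h1 (hF' z) (hG' z)⟩

lemma integral_mem_Icc {Ω : Type*} [MeasurableSpace Ω] {P : Measure Ω} [IsProbabilityMeasure P]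
    {F : Ω → ℝ} {a b : ℝ} (hF : Integrable F P) (hF' : ∀ z, F z ∈ Icc a b) :
    ∫ z, F z ∂P ∈ Icc a b := by
  constructor
  · simpa using integral_mono (integrable_const a) hF fun z => (hF' z).1
  · simpa using integral_mono hF (integrable_const b) fun z => (hF' z).2

/-- The partial derivative of `J ρ` in its first argument. -/
def JPart (ρ : ℝ) (z : ℝ × ℝ) : ℝ := Phi ((PhiInv z.2 - ρ * PhiInv z.1) / sig ρ)

/-- The pure second partial derivative of `J ρ` in its first argument. -/
def JPart₁ (ρ : ℝ) (z : ℝ × ℝ) : ℝ :=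
  phi ((PhiInv z.2 - ρ * PhiInv z.1) / sig ρ) * (-ρ * (phi (PhiInv z.1))⁻¹ / sig ρ)

/-- The mixed second partial derivative of `J ρ`. -/
def JPart₂ (ρ : ℝ) (z : ℝ × ℝ) : ℝ :=
  phi ((PhiInv z.2 - ρ * PhiInv z.1) / sig ρ) * ((phi (PhiInv z.2))⁻¹ / sig ρ)

lemma gaussianReal_Iic (h0 : 0 < ρ) (h1 : ρ < 1) (a b : ℝ) :
    (gaussianReal a (sigSq ρ)).real (Iic b) = Phi ((b - a) / sig ρ) := by
  have hσ := sig_pos h0 h1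
  rw [← gam_map_affine, map_measureReal_apply (by fun_prop) measurableSet_Iic, Phi_eq_gam]
  congr 1
  ext t
  simp only [mem_preimage, mem_Iic, le_div_iff₀ hσ]
  constructor <;> intro h <;> linarith

lemma J_eq_integral (h0 : 0 < ρ) (h1 : ρ < 1) {x y : ℝ} (hx : x ∈ Ioo (0 : ℝ) 1)
    (hy : y ∈ Ioo (0 : ℝ) 1) :
    J ρ x y = ∫ s in Iic (PhiInv x), phi s * Phi ((PhiInv y - ρ * s) / sig ρ) := by
  have hJ : J ρ x y =
      ∫ s in Iic (PhiInv x), ∫ t in Iic (PhiInv y), biGaussianDensity ρ (s, t) := by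
    simp [J, hx.1.ne', hx.2.ne, hy.1.ne', hy.2.ne, biGaussianDensity]
  rw [hJ]
  refine integral_congr_ae (ae_of_all _ fun s => ?_)
  simp only [biGaussianDensity_eq h0 h1]
  rw [integral_const_mul, ← gaussianReal_Iic h0 h1, Measure.real,
    gaussianReal_apply_eq_integral _ (sigSq_ne_zero h0 h1),
    ENNReal.toReal_ofReal (integral_nonneg fun x => gaussianPDFReal_nonneg _ _ _)]

lemma hasDerivAt_J (h0 : 0 < ρ) (h1 : ρ < 1) {x y : ℝ} (hx : x ∈ Ioo (0 : ℝ) 1)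
    (hy : y ∈ Ioo (0 : ℝ) 1) : HasDerivAt (fun x => J ρ x y) (JPart ρ (x, y)) x := by
  let g : ℝ → ℝ := fun s => phi s * Phi ((PhiInv y - ρ * s) / sig ρ)
  have hg : Continuous g :=
    contDiff_phi.continuous.mul (continuous_Phi.comp (by fun_prop))
  have hint : Integrable g := by
    refine (integrable_gaussianPDFReal 0 1).mono hg.aestronglyMeasurable (ae_of_all _ fun s => ?_)
    rw [norm_mul]
    refine mul_le_of_le_one_right (norm_nonneg _) ?_
    rw [Real.norm_eq_abs, abs_of_pos (Phi_pos _)]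
    exact (Phi_lt_one _).le
  have hI : ∀ a, HasDerivAt (fun a => ∫ s in Iic a, g s) (g a) a := by
    intro a
    have h : (fun a => ∫ s in Iic a, g s)
        = fun u => (∫ s in Iic 0, g s) + ∫ s in (0 : ℝ)..u, g s := by
      funext u
      rw [← intervalIntegral.integral_Iic_sub_Iic hint.integrableOn hint.integrableOn]
      ring
    rw [h]
    exact (intervalIntegral.integral_hasDerivAt_right hint.intervalIntegrable
      (hg.stronglyMeasurableAtFilter _ _) hg.continuousAt).const_add _
  have hc := (hI (PhiInv x)).comp x (hasDerivAt_PhiInv hx)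
  have he : g (PhiInv x) * (phi (PhiInv x))⁻¹ = JPart ρ (x, y) := by
    have := (phi_pos (PhiInv x)).ne'
    simp only [g, JPart]
    field_simp
  rw [he] at hc
  refine hc.congr_of_eventuallyEq ?_
  filter_upwards [Ioo_mem_nhds hx.1 hx.2] with u hu using J_eq_integral h0 h1 hu hy

lemma hasFDerivAt_JPart {z : ℝ × ℝ} (hz₁ : z.1 ∈ Ioo (0 : ℝ) 1) (hz₂ : z.2 ∈ Ioo (0 : ℝ) 1) :
    HasFDerivAt (JPart ρ) (JPart₁ ρ z • ContinuousLinearMap.fst ℝ ℝ ℝ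
      + JPart₂ ρ z • ContinuousLinearMap.snd ℝ ℝ ℝ) z := by
  have ha := (hasDerivAt_PhiInv hz₁).comp_hasFDerivAt z
    (hasFDerivAt_fst (𝕜 := ℝ) (E := ℝ) (F := ℝ) (p := z))
  have hb := (hasDerivAt_PhiInv hz₂).comp_hasFDerivAt z
    (hasFDerivAt_snd (𝕜 := ℝ) (E := ℝ) (F := ℝ) (p := z))
  have hr := (hb.sub (ha.const_mul ρ)).mul_const (sig ρ)⁻¹
  have := (hasDerivAt_Phi _).comp_hasFDerivAt z hr
  refine (this.congr_fderiv ?_).congr_of_eventuallyEq ?_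
  · ext <;> simp only [JPart₁, JPart₂, div_eq_mul_inv, ContinuousLinearMap.comp_apply,
      ContinuousLinearMap.inl_apply, ContinuousLinearMap.inr_apply, add_apply, smul_apply,
      sub_apply, ContinuousLinearMap.coe_fst', ContinuousLinearMap.coe_snd', smul_eq_mul,
      Pi.sub_apply, Function.comp_apply] <;> ring
  · exact Eventually.of_forall fun w => by simp [JPart, div_eq_mul_inv]

lemma contDiffOn_JPart : ContDiffOn ℝ 2 (JPart ρ) (Ioo (0 : ℝ) 1 ×ˢ Ioo (0 : ℝ) 1) := by
  rintro z ⟨hz₁, hz₂⟩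
  refine ContDiffAt.contDiffWithinAt ?_
  have ha : ContDiffAt ℝ 3 (fun w : ℝ × ℝ => PhiInv w.1) z :=
    (contDiffAt_PhiInv hz₁).comp z contDiffAt_fst
  have hb : ContDiffAt ℝ 3 (fun w : ℝ × ℝ => PhiInv w.2) z :=
    (contDiffAt_PhiInv hz₂).comp z contDiffAt_snd
  have hr : ContDiffAt ℝ 3 (fun w : ℝ × ℝ => (PhiInv w.2 - ρ * PhiInv w.1) / sig ρ) z :=
    (hb.sub (contDiffAt_const.mul ha)).div_const _
  exact ((contDiff_Phi.contDiffAt).comp z hr).of_le (by norm_num)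

/-- A `C²` function satisfies a uniform first-order Taylor estimate on a convex compact set. -/
lemma exists_taylor_bound {E : Type*} [NormedAddCommGroup E] [NormedSpace ℝ E] {F : E → ℝ}
    {U S : Set E} (hU : IsOpen U) (hS : IsCompact S) (hconv : Convex ℝ S) (hSU : S ⊆ U)
    (hF : ContDiffOn ℝ 2 F U) :
    ∃ C, 0 ≤ C ∧ ∀ z₀ ∈ S, ∀ z ∈ S, |F z - F z₀ - fderiv ℝ F z₀ (z - z₀)| ≤ C * ‖z - z₀‖ ^ 2 := by
  have hF' : ContDiffOn ℝ 1 (fderiv ℝ F) U := hF.fderiv_of_isOpen hU (by norm_num)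
  have hF'' : ContinuousOn (fderiv ℝ (fderiv ℝ F)) U :=
    hF'.continuousOn_fderiv_of_isOpen hU (by norm_num)
  obtain ⟨C, hC⟩ := hS.exists_bound_of_continuousOn (f := fderiv ℝ (fderiv ℝ F)) (hF''.mono hSU)
  refine ⟨max C 0, le_max_right _ _, fun z₀ hz₀ z hz => ?_⟩
  have hseg : segment ℝ z₀ z ⊆ S := hconv.segment_subset hz₀ hz
  have hlip : ∀ w ∈ S, ‖fderiv ℝ F w - fderiv ℝ F z₀‖ ≤ max C 0 * ‖w - z₀‖ := fun w hw =>
    hconv.norm_image_sub_le_of_norm_fderiv_le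
      (fun v hv => (hF'.differentiableOn (by norm_num)).differentiableAt (hU.mem_nhds (hSU hv)))
      (fun v hv => (hC v hv).trans (le_max_left _ _)) hz₀ hw
  have key := (convex_segment z₀ z).norm_image_sub_le_of_norm_hasFDerivWithin_le'
    (f := F) (f' := fderiv ℝ F) (φ := fderiv ℝ F z₀) (C := max C 0 * ‖z - z₀‖)
    (fun v hv => ((hF.differentiableOn (by norm_num)).differentiableAt
      (hU.mem_nhds (hSU (hseg hv)))).hasFDerivAt.hasFDerivWithinAt)
    (fun v hv => (hlip v (hseg hv)).trans (by
      gcongr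
      rw [norm_sub_rev v, norm_sub_rev z]
      have := norm_sub_le_of_mem_segment hv
      rw [norm_sub_rev v, norm_sub_rev z] at this
      exact this))
    (left_mem_segment ℝ z₀ z) (right_mem_segment ℝ z₀ z)
  rw [Real.norm_eq_abs] at key
  linarith

lemma exists_J_taylor_fst (h0 : 0 < ρ) (h1 : ρ < 1) {a b : ℝ} (ha : 0 < a) (hb : b < 1) :
    ∃ C, 0 ≤ C ∧ ∀ x₀ ∈ Icc a b, ∀ y₀ ∈ Icc a b, ∀ x ∈ Icc a b, ∀ y ∈ Icc a b,
      |J ρ x y - J ρ x₀ y - (JPart ρ (x₀, y₀) * (x - x₀) + JPart₁ ρ (x₀, y₀) * (x - x₀) ^ 2 / 2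
        + JPart₂ ρ (x₀, y₀) * (y - y₀) * (x - x₀))| ≤ C * (|x - x₀| + |y - y₀|) ^ 3 := by
  have hsub : Icc a b ⊆ Ioo (0 : ℝ) 1 := fun x hx => ⟨ha.trans_le hx.1, hx.2.trans_lt hb⟩
  obtain ⟨C, hC0, hC⟩ := exists_taylor_bound (isOpen_Ioo.prod isOpen_Ioo)
    (isCompact_Icc.prod isCompact_Icc) ((convex_Icc a b).prod (convex_Icc a b))
    (prod_mono hsub hsub) (contDiffOn_JPart (ρ := ρ))
  refine ⟨C, hC0, fun x₀ hx₀ y₀ hy₀ x hx y hy => ?_⟩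
  have huIcc : uIcc x₀ x ⊆ Icc a b := (convex_Icc a b).ordConnected.uIcc_subset hx₀ hx
  have hd : ∀ s ∈ uIcc x₀ x, HasDerivWithinAt (fun s => J ρ s y - (JPart ρ (x₀, y₀) * (s - x₀)
      + JPart₁ ρ (x₀, y₀) * (s - x₀) ^ 2 / 2 + JPart₂ ρ (x₀, y₀) * (y - y₀) * (s - x₀)))
      (JPart ρ (s, y) - JPart ρ (x₀, y₀) - (JPart₁ ρ (x₀, y₀) * (s - x₀)
        + JPart₂ ρ (x₀, y₀) * (y - y₀))) (uIcc x₀ x) s := by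
    intro s hs
    have e1 := hasDerivAt_J h0 h1 (hsub (huIcc hs)) (hsub hy)
    have e2 := (hasDerivAt_id s).sub_const x₀
    have e3 := ((e2.const_mul (JPart ρ (x₀, y₀))).add
      (((e2.pow 2).const_mul (JPart₁ ρ (x₀, y₀))).div_const 2)).add
      (e2.const_mul (JPart₂ ρ (x₀, y₀) * (y - y₀)))
    refine ((e1.sub e3).congr_deriv ?_).hasDerivWithinAt
    simp only [id]
    ring
  have hbd : ∀ s ∈ uIcc x₀ x, ‖JPart ρ (s, y) - JPart ρ (x₀, y₀) - (JPart₁ ρ (x₀, y₀) * (s - x₀)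
        + JPart₂ ρ (x₀, y₀) * (y - y₀))‖ ≤ C * (|x - x₀| + |y - y₀|) ^ 2 := by
    intro s hs
    have h := hC (x₀, y₀) ⟨hx₀, hy₀⟩ (s, y) ⟨huIcc hs, hy⟩
    rw [(hasFDerivAt_JPart (z := (x₀, y₀)) (hsub hx₀) (hsub hy₀)).fderiv] at h
    simp only [Prod.mk_sub_mk, add_apply, smul_apply,
      ContinuousLinearMap.coe_fst', ContinuousLinearMap.coe_snd', smul_eq_mul] at h
    rw [Real.norm_eq_abs]
    refine h.trans ?_
    have hs' : |s - x₀| ≤ |x - x₀| := abs_sub_left_of_mem_uIcc hs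
    gcongr
    rw [Prod.norm_mk, Real.norm_eq_abs, Real.norm_eq_abs]
    exact max_le (by linarith [abs_nonneg (y - y₀)]) (by linarith [abs_nonneg (x - x₀)])
  have key := (convex_uIcc x₀ x).norm_image_sub_le_of_norm_hasDerivWithin_le hd hbd
    left_mem_uIcc right_mem_uIcc
  rw [Real.norm_eq_abs, Real.norm_eq_abs] at key
  have hfin : C * (|x - x₀| + |y - y₀|) ^ 2 * |x - x₀| ≤ C * (|x - x₀| + |y - y₀|) ^ 3 := by
    rw [mul_assoc, pow_succ _ 2]
    gcongr
    linarith [abs_nonneg (y - y₀)]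
  refine le_trans (le_of_eq ?_) (key.trans hfin)
  congr 1
  ring

/-- Uniform second-order Taylor upper bound for `J ρ` away from the boundary of the square. -/
lemma exists_J_taylor (h0 : 0 < ρ) (h1 : ρ < 1) {a b : ℝ} (ha : 0 < a) (hb : b < 1) :
    ∃ C, 0 ≤ C ∧ ∀ x₀ ∈ Icc a b, ∀ y₀ ∈ Icc a b, ∀ x ∈ Icc a b, ∀ y ∈ Icc a b,
      J ρ x y ≤ J ρ x₀ y₀ + JPart ρ (x₀, y₀) * (x - x₀) + JPart ρ (y₀, x₀) * (y - y₀)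
        + (JPart₁ ρ (x₀, y₀) * (x - x₀) ^ 2 / 2 + JPart₂ ρ (x₀, y₀) * ((x - x₀) * (y - y₀))
          + JPart₁ ρ (y₀, x₀) * (y - y₀) ^ 2 / 2) + C * (|x - x₀| + |y - y₀|) ^ 3 := by
  have hsub : Icc a b ⊆ Icc (0 : ℝ) 1 := Icc_subset_Icc ha.le hb.le
  obtain ⟨C, hC0, hC⟩ := exists_J_taylor_fst h0 h1 ha hb
  refine ⟨2 * C, by positivity, fun x₀ hx₀ y₀ hy₀ x hx y hy => ?_⟩
  have e1 := (abs_le.1 (hC x₀ hx₀ y₀ hy₀ x hx y hy)).2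
  have e2 := (abs_le.1 (hC y₀ hy₀ x₀ hx₀ y hy x₀ hx₀)).2
  rw [J_comm h0 h1 (hsub hy) (hsub hx₀), J_comm h0 h1 (hsub hy₀) (hsub hx₀), sub_self x₀, abs_zero,
    add_zero] at e2
  have e3 : C * |y - y₀| ^ 3 ≤ C * (|x - x₀| + |y - y₀|) ^ 3 := by
    gcongr
    linarith [abs_nonneg (x - x₀)]
  linarith

lemma exists_JPart_bound {a b : ℝ} (ha : 0 < a) (hb : b < 1) :
    ∃ M, 0 ≤ M ∧ ∀ x ∈ Icc a b, ∀ y ∈ Icc a b, |JPart₁ ρ (x, y)| ≤ M ∧ |JPart₂ ρ (x, y)| ≤ M := by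
  have hsub : Icc a b ⊆ Ioo (0 : ℝ) 1 := fun x hx => ⟨ha.trans_le hx.1, hx.2.trans_lt hb⟩
  have hc : ContinuousOn (fderiv ℝ (JPart ρ)) (Ioo (0 : ℝ) 1 ×ˢ Ioo (0 : ℝ) 1) :=
    contDiffOn_JPart.continuousOn_fderiv_of_isOpen (isOpen_Ioo.prod isOpen_Ioo) (by norm_num)
  obtain ⟨M, hM⟩ := (isCompact_Icc.prod isCompact_Icc).exists_bound_of_continuousOn
    (hc.mono (prod_mono hsub hsub))
  refine ⟨max M 0, le_max_right _ _, fun x hx y hy => ?_⟩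
  have h := hM (x, y) ⟨hx, hy⟩
  have hd := (hasFDerivAt_JPart (ρ := ρ) (z := (x, y)) (hsub hx) (hsub hy)).fderiv
  constructor
  · have h' := (fderiv ℝ (JPart ρ) (x, y)).le_of_opNorm_le h (1, 0)
    rw [hd] at h'
    refine le_trans ?_ (h'.trans ?_) <;> simp [Prod.norm_mk]
  · have h' := (fderiv ℝ (JPart ρ) (x, y)).le_of_opNorm_le h (0, 1)
    rw [hd] at h'
    refine le_trans ?_ (h'.trans ?_) <;> simp [Prod.norm_mk]

/-- The Hessian of `J ρ`, with its mixed entries multiplied by `ρ`, is negative semidefinite. -/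
lemma J_hessian_nonpos (h0 : 0 < ρ) (h1 : ρ < 1) (x y u v : ℝ) :
    JPart₁ ρ (x, y) * u ^ 2 / 2 + JPart₂ ρ (x, y) * (ρ * (u * v))
      + JPart₁ ρ (y, x) * v ^ 2 / 2 ≤ 0 := by
  have hσ := sig_pos h0 h1
  have hσ2 := sig_sq h0 h1
  simp only [JPart₁, JPart₂]
  set a := PhiInv x
  set b := PhiInv y
  have hp := phi_pos a
  have hq := phi_pos b
  have hE := phi_pos ((b - ρ * a) / sig ρ)
  have hD : phi ((b - ρ * a) / sig ρ) * phi a = phi ((a - ρ * b) / sig ρ) * phi b := by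
    simp only [phi_eq, div_mul_div_comm, ← Real.exp_add]
    congr 2
    rw [div_pow, div_pow, hσ2]
    have := (one_sub_sq_pos h0 h1).ne'
    field_simp
    ring
  have hD' : phi ((a - ρ * b) / sig ρ) = phi ((b - ρ * a) / sig ρ) * phi a / phi b := by
    rw [hD]
    field_simp
  rw [hD']
  have : phi ((b - ρ * a) / sig ρ) * (-ρ * (phi a)⁻¹ / sig ρ) * u ^ 2 / 2
      + phi ((b - ρ * a) / sig ρ) * ((phi b)⁻¹ / sig ρ) * (ρ * (u * v))
      + phi ((b - ρ * a) / sig ρ) * phi a / phi b * (-ρ * (phi b)⁻¹ / sig ρ) * v ^ 2 / 2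
      = -(ρ * phi ((b - ρ * a) / sig ρ) * phi a / (2 * sig ρ) * (u / phi a - v / phi b) ^ 2) := by
    field_simp
    ring
  rw [this]
  exact neg_nonpos.2 (by positivity)

/-- `f` takes values in `[a, b]`, is `L`-Lipschitz, and has first-order Taylor expansions with
derivative `f'` and remainder at most `L t ^ 2`. -/
structure IsSmoothBounded (a b L : ℝ) (f f' : ℝ → ℝ) : Prop where
  measurable : Measurable f
  measurable' : Measurable f'
  mem_Icc : ∀ x, f x ∈ Icc a b
  deriv_le : ∀ x, |f' x| ≤ L
  lipschitz : ∀ x t, |f (x + t) - f x| ≤ L * |t|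
  taylor : ∀ x t, |f (x + t) - f x - t * f' x| ≤ L * t ^ 2

lemma integrable_of_forall_mem_Icc {Ω : Type*} [MeasurableSpace Ω] {P : Measure Ω}
    [IsFiniteMeasure P] {F : Ω → ℝ} {a b : ℝ} (hF : Measurable F) (hF' : ∀ z, F z ∈ Icc a b) :
    Integrable F P :=
  Integrable.of_mem_Icc a b hF.aemeasurable (ae_of_all _ hF')

lemma IsSmoothBounded.average {Ω : Type*} [MeasurableSpace Ω] {P : Measure Ω}
    [IsProbabilityMeasure P] {a b L : ℝ} {f f' : ℝ → ℝ} (h : IsSmoothBounded a b L f f')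
    {T : Ω → ℝ} (hT : Measurable T) :
    IsSmoothBounded a b L (fun x => ∫ ω, f (x + T ω) ∂P) (fun x => ∫ ω, f' (x + T ω) ∂P) := by
  have hm : Measurable fun q : ℝ × Ω => q.1 + T q.2 := by fun_prop
  have hi : ∀ x, Integrable (fun ω => f (x + T ω)) P := fun x =>
    integrable_of_forall_mem_Icc (h.measurable.comp (hT.const_add x)) fun ω => h.mem_Icc _
  have hi' : ∀ x, Integrable (fun ω => f' (x + T ω)) P := fun x =>
    integrable_of_forall_mem_Icc (h.measurable'.comp (hT.const_add x))
      fun ω => abs_le.1 (h.deriv_le _)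
  have hle : ∀ {F : Ω → ℝ} {c : ℝ}, (∀ ω, |F ω| ≤ c) → |∫ ω, F ω ∂P| ≤ c := fun {F c} hF => by
    simpa using norm_integral_le_of_norm_le_const (μ := P) (f := F) (C := c) (ae_of_all _ hF)
  refine ⟨?_, ?_, fun x => integral_mem_Icc (hi x) fun ω => h.mem_Icc _,
    fun x => hle fun ω => h.deriv_le _, fun x t => ?_, fun x t => ?_⟩
  · exact (h.measurable.comp hm).stronglyMeasurable.integral_prod_right'.measurable
  · exact (h.measurable'.comp hm).stronglyMeasurable.integral_prod_right'.measurable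
  · rw [← integral_sub (hi _) (hi _)]
    refine hle fun ω => ?_
    rw [add_right_comm]
    exact h.lipschitz _ _
  · have hs : Integrable (fun ω => f (x + t + T ω) - f (x + T ω)) P := (hi _).sub (hi _)
    rw [← integral_sub (hi _) (hi _), ← integral_const_mul,
      ← integral_sub hs ((hi' _).const_mul t)]
    refine hle fun ω => ?_
    rw [add_right_comm]
    exact h.taylor _ _

lemma abs_mul_sub_mul_le {p q s t D E : ℝ} (hp : |p| ≤ D) (ht : |t| ≤ D) (hps : |p - s| ≤ E)
    (hqt : |q - t| ≤ E) : |p * q - s * t| ≤ 2 * (D * E) := by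
  have hD := (abs_nonneg p).trans hp
  have h : p * q - s * t = p * (q - t) + (p - s) * t := by ring
  rw [h]
  refine (abs_add_le _ _).trans ?_
  rw [abs_mul, abs_mul]
  have h1 : |p| * |q - t| ≤ D * E := by gcongr
  have h2 : |p - s| * |t| ≤ E * D := by
    have := (abs_nonneg _).trans hps
    gcongr
  linarith

lemma mul_le_mul_add_of_abs_le {α M p s E : ℝ} (hα : |α| ≤ M) (h : |p - s| ≤ E) :
    α * p ≤ α * s + M * E := by
  have h1 : α * (p - s) ≤ M * E := by
    refine (le_abs_self _).trans ?_
    rw [abs_mul]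
    have := (abs_nonneg _).trans hα
    gcongr
  linarith

/-- Replacing the arguments of a quadratic form by nearby ones. -/
lemma quadratic_le_quadratic_add {α β γ M p q s t D E : ℝ} (hα : |α| ≤ M) (hβ : |β| ≤ M)
    (hγ : |γ| ≤ M) (hp : |p| ≤ D) (hq : |q| ≤ D) (hs : |s| ≤ D) (ht : |t| ≤ D)
    (hps : |p - s| ≤ E) (hqt : |q - t| ≤ E) :
    α * p ^ 2 / 2 + β * (p * q) + γ * q ^ 2 / 2
      ≤ α * s ^ 2 / 2 + β * (s * t) + γ * t ^ 2 / 2 + 4 * M * (D * E) := by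
  have h1 := mul_le_mul_add_of_abs_le hα (abs_mul_sub_mul_le hp hs hps hps)
  have h2 := mul_le_mul_add_of_abs_le hβ (abs_mul_sub_mul_le hp ht hps hqt)
  have h3 := mul_le_mul_add_of_abs_le hγ (abs_mul_sub_mul_le hq ht hqt hqt)
  simp only [pow_two]
  linarith

lemma memLp_fst_biGaussian (h0 : 0 < ρ) (h1 : ρ < 1) {p : ENNReal} (hp : p ≠ ⊤) :
    MemLp (fun z : ℝ × ℝ => z.1) p (biGaussian ρ) := by
  have := isGaussian_biGaussian h0 h1
  exact IsGaussian.memLp_dual (biGaussian ρ) (ContinuousLinearMap.fst ℝ ℝ ℝ) p hp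

lemma memLp_snd_biGaussian (h0 : 0 < ρ) (h1 : ρ < 1) {p : ENNReal} (hp : p ≠ ⊤) :
    MemLp (fun z : ℝ × ℝ => z.2) p (biGaussian ρ) := by
  have := isGaussian_biGaussian h0 h1
  exact IsGaussian.memLp_dual (biGaussian ρ) (ContinuousLinearMap.snd ℝ ℝ ℝ) p hp

lemma integrable_cube_biGaussian (h0 : 0 < ρ) (h1 : ρ < 1) :
    Integrable (fun z : ℝ × ℝ => (1 + |z.1| + |z.2|) ^ 3) (biGaussian ρ) := by
  have := isProbabilityMeasure_biGaussian h0 h1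
  have hc : MemLp (fun _ : ℝ × ℝ => (1 : ℝ)) 3 (biGaussian ρ) := memLp_const 1
  have hf := (memLp_fst_biGaussian h0 h1 (p := 3) (by simp)).norm
  have hs := (memLp_snd_biGaussian h0 h1 (p := 3) (by simp)).norm
  have h : MemLp (fun z : ℝ × ℝ => 1 + ‖z.1‖ + ‖z.2‖) 3 (biGaussian ρ) := (hc.add hf).add hs
  have h3 := h.integrable_norm_pow (p := 3) (by simp)
  refine h3.congr (ae_of_all _ fun z => ?_)
  simp only [Real.norm_eq_abs]
  rw [abs_of_nonneg (by positivity)]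

/-- Deviation of a small Gaussian perturbation of `f` from its mean. -/
lemma IsSmoothBounded.deviation {Ω : Type*} [MeasurableSpace Ω] {P : Measure Ω}
    [IsProbabilityMeasure P] {a b L : ℝ} {f f' : ℝ → ℝ} (h : IsSmoothBounded a b L f f')
    {X : Ω → ℝ} (hX : Measurable X) (hX2 : MemLp X 2 P) (hX0 : ∫ ω, X ω ∂P = 0)
    (hX1 : ∫ ω, X ω ^ 2 ∂P = 1) {c : ℝ} (hc0 : 0 ≤ c) (hc1 : c ≤ 1) (x : ℝ) (ω : Ω) :
    |f (x + c * X ω) - ∫ ω, f (x + c * X ω) ∂P| ≤ L * c * (1 + |X ω|) ∧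
    |f (x + c * X ω) - (∫ ω, f (x + c * X ω) ∂P) - c * X ω * f' x|
      ≤ L * c ^ 2 * (1 + |X ω|) ^ 2 := by
  have hL : 0 ≤ L := (abs_nonneg _).trans (h.deriv_le 0)
  have hi : Integrable (fun ω => f (x + c * X ω)) P :=
    integrable_of_forall_mem_Icc (h.measurable.comp ((hX.const_mul c).const_add x))
      fun ω => h.mem_Icc _
  have hiX : Integrable X P := hX2.integrable (by norm_num)
  have hs : Integrable (fun ω => f (x + c * X ω) - f x) P := hi.sub (integrable_const _)
  have hm : |(∫ ω, f (x + c * X ω) ∂P) - f x| ≤ L * c ^ 2 := by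
    have e : (∫ ω, f (x + c * X ω) ∂P) - f x
        = ∫ ω, (f (x + c * X ω) - f x - c * X ω * f' x) ∂P := by
      rw [integral_sub hs ((hiX.const_mul c).mul_const _),
        integral_sub hi (integrable_const _), integral_mul_const, integral_const_mul, hX0]
      simp
    rw [e]
    calc |∫ ω, (f (x + c * X ω) - f x - c * X ω * f' x) ∂P|
        ≤ ∫ ω, |f (x + c * X ω) - f x - c * X ω * f' x| ∂P := abs_integral_le_integral_abs
      _ ≤ ∫ ω, L * c ^ 2 * X ω ^ 2 ∂P := by
          refine integral_mono (hs.sub ((hiX.const_mul c).mul_const _)).abs (hX2.integrable_sq.const_mul _) fun ω => ?_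
          refine (h.taylor x (c * X ω)).trans (le_of_eq ?_)
          ring
      _ = L * c ^ 2 := by rw [integral_const_mul, hX1, mul_one]
  set m := ∫ ω, f (x + c * X ω) ∂P
  have hl := h.lipschitz x (c * X ω)
  have ht := h.taylor x (c * X ω)
  rw [abs_mul, abs_of_nonneg hc0] at hl
  constructor
  · have : L * c ^ 2 ≤ L * c := by
      gcongr
      nlinarith
    have h3 := abs_sub_le (f (x + c * X ω)) (f x) m
    rw [abs_sub_comm (f x)] at h3
    linarith
  · have h3 : f (x + c * X ω) - m - c * X ω * f' x
        = (f (x + c * X ω) - f x - c * X ω * f' x) - (m - f x) := by ring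
    rw [h3]
    refine (abs_sub _ _).trans ((add_le_add ht hm).trans ?_)
    have : L * (c * X ω) ^ 2 + L * c ^ 2 = L * c ^ 2 * (1 + |X ω| ^ 2) := by
      rw [sq_abs]
      ring
    rw [this]
    gcongr
    nlinarith [abs_nonneg (X ω)]

/-- The inequality for a Gaussian perturbation of size `c`, up to an error of order `c ^ 3`. -/
lemma exists_small_step (h0 : 0 < ρ) (h1 : ρ < 1) {a b L : ℝ} (ha : 0 < a) (hb : b < 1) :
    ∃ K, ∀ f f' g g' : ℝ → ℝ, IsSmoothBounded a b L f f' → IsSmoothBounded a b L g g' →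
      ∀ c ∈ Icc (0 : ℝ) 1, ∀ x y : ℝ,
      ∫ p, J ρ (f (x + c * p.1)) (g (y + c * p.2)) ∂(biGaussian ρ)
        ≤ J ρ (∫ p, f (x + c * p.1) ∂(biGaussian ρ)) (∫ p, g (y + c * p.2) ∂(biGaussian ρ))
          + K * c ^ 3 := by
  have := isProbabilityMeasure_biGaussian h0 h1
  obtain ⟨C, hC0, hC⟩ := exists_J_taylor h0 h1 ha hb
  obtain ⟨M, hM0, hM⟩ := exists_JPart_bound (ρ := ρ) ha hb
  set K₀ : ℝ := 4 * M * L ^ 2 + 8 * C * L ^ 3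
  refine ⟨K₀ * ∫ p, (1 + |p.1| + |p.2|) ^ 3 ∂(biGaussian ρ), fun f f' g g' hf hg c hc x y => ?_⟩
  have hL : 0 ≤ L := (abs_nonneg _).trans (hf.deriv_le 0)
  have h2 : (2 : ENNReal) ≠ ⊤ := by simp
  have hU := memLp_fst_biGaussian h0 h1 h2
  have hV := memLp_snd_biGaussian h0 h1 h2
  have hUV : Integrable (fun p : ℝ × ℝ => p.1 * p.2) (biGaussian ρ) := hU.integrable_mul hV
  have hsub : Icc a b ⊆ Icc (0 : ℝ) 1 := Icc_subset_Icc ha.le hb.le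
  have hfm : Measurable fun p : ℝ × ℝ => f (x + c * p.1) := hf.measurable.comp (by fun_prop)
  have hgm : Measurable fun p : ℝ × ℝ => g (y + c * p.2) := hg.measurable.comp (by fun_prop)
  have hfi : Integrable (fun p : ℝ × ℝ => f (x + c * p.1)) (biGaussian ρ) :=
    integrable_of_forall_mem_Icc hfm fun p => hf.mem_Icc _
  have hgi : Integrable (fun p : ℝ × ℝ => g (y + c * p.2)) (biGaussian ρ) :=
    integrable_of_forall_mem_Icc hgm fun p => hg.mem_Icc _
  have hdf := hf.deviation measurable_fst hU (biGaussian_integral_fst h0 h1)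
    (biGaussian_sq_fst h0 h1) hc.1 hc.2 x
  have hdg := hg.deviation measurable_snd hV (biGaussian_integral_snd h0 h1)
    (biGaussian_sq_snd h0 h1) hc.1 hc.2 y
  have hm : ∫ p, f (x + c * p.1) ∂(biGaussian ρ) ∈ Icc a b :=
    integral_mem_Icc hfi fun p => hf.mem_Icc _
  have hn : ∫ p, g (y + c * p.2) ∂(biGaussian ρ) ∈ Icc a b :=
    integral_mem_Icc hgi fun p => hg.mem_Icc _
  set m := ∫ p, f (x + c * p.1) ∂(biGaussian ρ) with hmdef
  set n := ∫ p, g (y + c * p.2) ∂(biGaussian ρ) with hndef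
  have hpt : ∀ p : ℝ × ℝ, J ρ (f (x + c * p.1)) (g (y + c * p.2)) ≤ J ρ m n
      + JPart ρ (m, n) * (f (x + c * p.1) - m) + JPart ρ (n, m) * (g (y + c * p.2) - n)
      + (c ^ 2 * (JPart₁ ρ (m, n) * f' x ^ 2 / 2) * p.1 ^ 2
        + c ^ 2 * (JPart₂ ρ (m, n) * (f' x * g' y)) * (p.1 * p.2)
        + c ^ 2 * (JPart₁ ρ (n, m) * g' y ^ 2 / 2) * p.2 ^ 2)
      + K₀ * c ^ 3 * (1 + |p.1| + |p.2|) ^ 3 := by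
    intro p
    have hW : 0 ≤ 1 + |p.1| + |p.2| := by positivity
    have hW1 : 1 + |p.1| ≤ 1 + |p.1| + |p.2| := by linarith [abs_nonneg p.2]
    have hW2 : 1 + |p.2| ≤ 1 + |p.1| + |p.2| := by linarith [abs_nonneg p.1]
    have hLc : 0 ≤ L * c := mul_nonneg hL hc.1
    have d1 : |f (x + c * p.1) - m| ≤ L * c * (1 + |p.1| + |p.2|) :=
      (hdf p).1.trans (by gcongr)
    have d2 : |g (y + c * p.2) - n| ≤ L * c * (1 + |p.1| + |p.2|) :=
      (hdg p).1.trans (by gcongr)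
    have d3 : |f (x + c * p.1) - m - c * p.1 * f' x| ≤ L * c ^ 2 * (1 + |p.1| + |p.2|) ^ 2 :=
      (hdf p).2.trans (by gcongr)
    have d4 : |g (y + c * p.2) - n - c * p.2 * g' y| ≤ L * c ^ 2 * (1 + |p.1| + |p.2|) ^ 2 :=
      (hdg p).2.trans (by gcongr)
    have d5 : |c * p.1 * f' x| ≤ L * c * (1 + |p.1| + |p.2|) := by
      rw [abs_mul, abs_mul, abs_of_nonneg hc.1]
      calc c * |p.1| * |f' x| ≤ c * (1 + |p.1| + |p.2|) * L := by
            have := hc.1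
            gcongr
            · linarith
            · exact hf.deriv_le x
        _ = _ := by ring
    have d6 : |c * p.2 * g' y| ≤ L * c * (1 + |p.1| + |p.2|) := by
      rw [abs_mul, abs_mul, abs_of_nonneg hc.1]
      calc c * |p.2| * |g' y| ≤ c * (1 + |p.1| + |p.2|) * L := by
            have := hc.1
            gcongr
            · linarith
            · exact hg.deriv_le y
        _ = _ := by ring
    have hq := quadratic_le_quadratic_add (hM m hm n hn).1 (hM m hm n hn).2 (hM n hn m hm).1
      d1 d2 d5 d6 d3 d4
    have hcub : C * (|f (x + c * p.1) - m| + |g (y + c * p.2) - n|) ^ 3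
        ≤ C * (L * c * (1 + |p.1| + |p.2|) + L * c * (1 + |p.1| + |p.2|)) ^ 3 := by
      gcongr
    have ht := hC m hm n hn _ (hf.mem_Icc (x + c * p.1)) _ (hg.mem_Icc (y + c * p.2))
    refine ht.trans ((add_le_add (add_le_add_right hq _) hcub).trans (le_of_eq ?_))
    simp only [K₀]
    ring
  have hJi : Integrable (fun p : ℝ × ℝ => J ρ (f (x + c * p.1)) (g (y + c * p.2)))
      (biGaussian ρ) :=
    integrable_J_comp h0 h1 hfm hgm (fun p => hsub (hf.mem_Icc _)) fun p => hsub (hg.mem_Icc _)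
  have i1 := ((hfi.sub (integrable_const m)).const_mul (JPart ρ (m, n)))
  have i2 := ((hgi.sub (integrable_const n)).const_mul (JPart ρ (n, m)))
  have i0 : Integrable (fun _ : ℝ × ℝ => J ρ m n) (biGaussian ρ) := integrable_const _
  have i3 := hU.integrable_sq.const_mul (c ^ 2 * (JPart₁ ρ (m, n) * f' x ^ 2 / 2))
  have i4 := hUV.const_mul (c ^ 2 * (JPart₂ ρ (m, n) * (f' x * g' y)))
  have i5 := hV.integrable_sq.const_mul (c ^ 2 * (JPart₁ ρ (n, m) * g' y ^ 2 / 2))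
  have i6 := (integrable_cube_biGaussian h0 h1).const_mul (K₀ * c ^ 3)
  have i34 := i3.add i4
  have i345 := i34.add i5
  have i01 := i0.add i1
  have i012 := i01.add i2
  have iq := i012.add i345
  have hle := integral_mono hJi (iq.add i6) hpt
  refine hle.trans ?_
  rw [integral_add' iq i6, integral_add' i012 i345, integral_add' i01 i2, integral_add' i0 i1,
    integral_add' i34 i5, integral_add' i3 i4]
  simp only [integral_const_mul]
  rw [integral_sub' hfi (integrable_const _), integral_sub' hgi (integrable_const _),
    biGaussian_sq_fst h0 h1, biGaussian_sq_snd h0 h1, biGaussian_fst_mul_snd h0 h1, ← hmdef,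
    ← hndef]
  simp only [integral_const, probReal_univ, one_smul, sub_self, mul_zero, add_zero, mul_one]
  have hH := mul_le_mul_of_nonneg_left (J_hessian_nonpos h0 h1 m n (f' x) (g' y)) (sq_nonneg c)
  nlinarith [hH]

/-- A Gaussian vector of variance `k + 1` splits as an independent sum. -/
lemma integral_biGaussian_sqrt_succ (h0 : 0 < ρ) (h1 : ρ < 1) (k : ℕ) {F : ℝ × ℝ → ℝ} {a b : ℝ}
    (hF : Measurable F) (hF' : ∀ z, F z ∈ Icc a b) :
    ∫ p, F (√(k + 1 : ℕ) • p) ∂(biGaussian ρ)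
      = ∫ q, ∫ r, F (√k • q + r) ∂(biGaussian ρ) ∂(biGaussian ρ) := by
  have := isProbabilityMeasure_biGaussian h0 h1
  have hk : (0 : ℝ) < k + 1 := by positivity
  have hs : 0 < √(k + 1 : ℕ) := Real.sqrt_pos.2 (by positivity)
  have hle : √k / √(k + 1 : ℕ) ≤ 1 := by
    rw [div_le_one hs]
    exact Real.sqrt_le_sqrt (by simp)
  have hcos : Real.cos (Real.arccos (√k / √(k + 1 : ℕ))) = √k / √(k + 1 : ℕ) :=
    Real.cos_arccos ((by norm_num : (-1 : ℝ) ≤ 0).trans (by positivity)) hle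
  have hsin : Real.sin (Real.arccos (√k / √(k + 1 : ℕ))) = 1 / √(k + 1 : ℕ) := by
    rw [Real.sin_arccos, div_pow, Real.sq_sqrt (by positivity), Real.sq_sqrt (by positivity)]
    have : 1 - (k : ℝ) / (k + 1 : ℕ) = 1 / (k + 1 : ℕ) := by
      push_cast
      field_simp
      ring
    rw [this, Real.sqrt_div zero_le_one, Real.sqrt_one]
  have hFm : Measurable fun q : (ℝ × ℝ) × (ℝ × ℝ) => F (√k • q.1 + q.2) := hF.comp (by fun_prop)
  have hFs : Measurable fun p : ℝ × ℝ => F (√(k + 1 : ℕ) • p) := hF.comp (by fun_prop)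
  rw [← integral_prod (fun q : (ℝ × ℝ) × (ℝ × ℝ) => F (√k • q.1 + q.2))
    (integrable_of_forall_mem_Icc hFm fun q => hF' _)]
  nth_rewrite 1 [← biGaussian_map_rotation h0 h1 (Real.arccos (√k / √(k + 1 : ℕ)))]
  rw [integral_map (by fun_prop) hFs.aestronglyMeasurable]
  refine integral_congr_ae (ae_of_all _ fun q => ?_)
  simp only [hcos, hsin, smul_add, smul_smul]
  rw [mul_div_cancel₀ _ hs.ne', mul_one_div_cancel hs.ne', one_smul]

lemma exists_iterated_step (h0 : 0 < ρ) (h1 : ρ < 1) {a b L : ℝ} (ha : 0 < a) (hb : b < 1) :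
    ∃ K, ∀ k : ℕ, ∀ f f' g g' : ℝ → ℝ, IsSmoothBounded a b L f f' → IsSmoothBounded a b L g g' →
      ∀ c ∈ Icc (0 : ℝ) 1, ∀ x y : ℝ,
      ∫ p, J ρ (f (x + c * (√k • p).1)) (g (y + c * (√k • p).2)) ∂(biGaussian ρ)
        ≤ J ρ (∫ p, f (x + c * (√k • p).1) ∂(biGaussian ρ))
            (∫ p, g (y + c * (√k • p).2) ∂(biGaussian ρ)) + k * (K * c ^ 3) := by
  have := isProbabilityMeasure_biGaussian h0 h1
  have hsub : Icc a b ⊆ Icc (0 : ℝ) 1 := Icc_subset_Icc ha.le hb.le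
  obtain ⟨K, hK⟩ := exists_small_step h0 h1 (L := L) ha hb
  refine ⟨K, fun k => ?_⟩
  induction k with
  | zero => intro f f' g g' hf hg c hc x y; simp
  | succ k ih =>
    intro f f' g g' hf hg c hc x y
    have hfm : Measurable fun p : ℝ × ℝ => f (x + c * p.1) := hf.measurable.comp (by fun_prop)
    have hgm : Measurable fun p : ℝ × ℝ => g (y + c * p.2) := hg.measurable.comp (by fun_prop)
    have hF := hf.average (P := biGaussian ρ) (measurable_fst.const_mul c)
    have hG := hg.average (P := biGaussian ρ) (measurable_snd.const_mul c)
    have hJm : Measurable fun p : ℝ × ℝ => J ρ (f (x + c * p.1)) (g (y + c * p.2)) :=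
      measurable_J_comp h0 h1 hfm hgm (fun p => hsub (hf.mem_Icc _)) fun p => hsub (hg.mem_Icc _)
    have hJ' : ∀ p : ℝ × ℝ, J ρ (f (x + c * p.1)) (g (y + c * p.2)) ∈ Icc (0 : ℝ) 1 := fun p =>
      ⟨J_nonneg h0 h1 (hsub (hf.mem_Icc _)) (hsub (hg.mem_Icc _)),
        J_le_one h0 h1 (hsub (hf.mem_Icc _)) (hsub (hg.mem_Icc _))⟩
    have e1 := integral_biGaussian_sqrt_succ h0 h1 k hJm hJ'
    have e2 := integral_biGaussian_sqrt_succ h0 h1 k hfm fun p => hf.mem_Icc _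
    have e3 := integral_biGaussian_sqrt_succ h0 h1 k hgm fun p => hg.mem_Icc _
    have hind := ih _ _ _ _ hF hG c hc x y
    simp only [Prod.fst_add, Prod.snd_add, mul_add, ← add_assoc] at e1 e2 e3
    rw [e1, e2, e3]
    have hin : ∀ q : ℝ × ℝ,
        ∫ r, J ρ (f (x + c * (√k • q).1 + c * r.1)) (g (y + c * (√k • q).2 + c * r.2))
          ∂(biGaussian ρ)
        ≤ J ρ (∫ r, f (x + c * (√k • q).1 + c * r.1) ∂(biGaussian ρ))
          (∫ r, g (y + c * (√k • q).2 + c * r.2) ∂(biGaussian ρ)) + K * c ^ 3 := fun q =>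
      hK f f' g g' hf hg c hc _ _
    have hm1 : Measurable fun q : ℝ × ℝ => x + c * (√k • q).1 := by fun_prop
    have hm2 : Measurable fun q : ℝ × ℝ => y + c * (√k • q).2 := by fun_prop
    have hi2 : Integrable (fun q : ℝ × ℝ =>
        J ρ (∫ r, f (x + c * (√k • q).1 + c * r.1) ∂(biGaussian ρ))
          (∫ r, g (y + c * (√k • q).2 + c * r.2) ∂(biGaussian ρ))) (biGaussian ρ) :=
      integrable_J_comp h0 h1 (hF.measurable.comp hm1) (hG.measurable.comp hm2)
        (fun q => hsub (hF.mem_Icc _)) fun q => hsub (hG.mem_Icc _)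
    have hm3 : Measurable fun z : (ℝ × ℝ) × (ℝ × ℝ) =>
        J ρ (f (x + c * (√k • z.1).1 + c * z.2.1)) (g (y + c * (√k • z.1).2 + c * z.2.2)) :=
      measurable_J_comp h0 h1 (hf.measurable.comp (by fun_prop)) (hg.measurable.comp (by fun_prop))
        (fun p => hsub (hf.mem_Icc _)) fun p => hsub (hg.mem_Icc _)
    have hi1 : Integrable (fun q : ℝ × ℝ =>
        ∫ r, J ρ (f (x + c * (√k • q).1 + c * r.1)) (g (y + c * (√k • q).2 + c * r.2))
          ∂(biGaussian ρ)) (biGaussian ρ) :=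
      (integrable_of_forall_mem_Icc (a := 0) (b := 1) hm3 fun z =>
        ⟨J_nonneg h0 h1 (hsub (hf.mem_Icc _)) (hsub (hg.mem_Icc _)),
          J_le_one h0 h1 (hsub (hf.mem_Icc _)) (hsub (hg.mem_Icc _))⟩).integral_prod_left
    have hle := integral_mono hi1 (hi2.add (integrable_const _)) hin
    rw [integral_add' hi2 (integrable_const _)] at hle
    simp only [integral_const, probReal_univ, one_smul] at hle
    push_cast
    linarith

/-- The one-dimensional inequality for smooth functions bounded away from `0` and `1`. -/
lemma borell_of_isSmoothBounded (h0 : 0 < ρ) (h1 : ρ < 1) {a b L : ℝ} (ha : 0 < a) (hb : b < 1)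
    {f f' g g' : ℝ → ℝ} (hf : IsSmoothBounded a b L f f') (hg : IsSmoothBounded a b L g g') :
    ∫ p, J ρ (f p.1) (g p.2) ∂(biGaussian ρ)
      ≤ J ρ (∫ p, f p.1 ∂(biGaussian ρ)) (∫ p, g p.2 ∂(biGaussian ρ)) := by
  obtain ⟨K, hK⟩ := exists_iterated_step h0 h1 (L := L) ha hb
  have hlim : Tendsto (fun n : ℕ => J ρ (∫ p, f p.1 ∂(biGaussian ρ))
      (∫ p, g p.2 ∂(biGaussian ρ)) + K * (1 / √(n + 1 : ℕ))) atTop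
      (𝓝 (J ρ (∫ p, f p.1 ∂(biGaussian ρ)) (∫ p, g p.2 ∂(biGaussian ρ)) + K * 0)) := by
    refine tendsto_const_nhds.add (tendsto_const_nhds.mul ?_)
    simp only [one_div]
    exact (Real.tendsto_sqrt_atTop.comp
      (tendsto_natCast_atTop_atTop.comp (tendsto_add_atTop_nat 1))).inv_tendsto_atTop
  rw [mul_zero, add_zero] at hlim
  refine ge_of_tendsto' hlim fun n => ?_
  have hs : 0 < √(n + 1 : ℕ) := Real.sqrt_pos.2 (by positivity)
  have hs1 : 1 ≤ √(n + 1 : ℕ) := Real.one_le_sqrt.2 (by simp)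
  have h := hK (n + 1) f f' g g' hf hg (1 / √(n + 1 : ℕ))
    ⟨by positivity, (div_le_one hs).2 hs1⟩ 0 0
  have he : ∀ t : ℝ, 0 + 1 / √(n + 1 : ℕ) * (√(n + 1 : ℕ) * t) = t := fun t => by
    field_simp
    ring
  simp only [Prod.smul_fst, Prod.smul_snd, smul_eq_mul, he] at h
  refine h.trans (le_of_eq ?_)
  have hsq : ((n + 1 : ℕ) : ℝ) = √(n + 1 : ℕ) ^ 2 := (Real.sq_sqrt (by positivity)).symm
  congr 1
  rw [div_pow, one_pow]
  nth_rewrite 1 [hsq]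
  field_simp

lemma IsSmoothBounded.mono {a b L a₁ b₁ L₁ : ℝ} {f f' : ℝ → ℝ} (h : IsSmoothBounded a b L f f')
    (ha : a₁ ≤ a) (hb : b ≤ b₁) (hL : L ≤ L₁) : IsSmoothBounded a₁ b₁ L₁ f f' where
  measurable := h.measurable
  measurable' := h.measurable'
  mem_Icc x := Icc_subset_Icc ha hb (h.mem_Icc x)
  deriv_le x := (h.deriv_le x).trans hL
  lipschitz x t := (h.lipschitz x t).trans (by gcongr)
  taylor x t := (h.taylor x t).trans (by gcongr)

lemma exists_isSmoothBounded_of_contDiff {a b : ℝ} {g : ℝ → ℝ} (hg : ContDiff ℝ 2 g)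
    (hsupp : HasCompactSupport g) (hab : ∀ x, g x ∈ Icc a b) :
    ∃ L, IsSmoothBounded a b L g (deriv g) := by
  have hg1 : ContDiff ℝ 1 (deriv g) := hg.deriv'
  obtain ⟨C₁, hC₁⟩ := hg1.continuous.bounded_above_of_compact_support hsupp.deriv
  obtain ⟨C₂, hC₂⟩ := hg1.continuous_deriv_one.bounded_above_of_compact_support hsupp.deriv.deriv
  have hd : Differentiable ℝ g := hg.differentiable (by norm_num)
  have hd1 : Differentiable ℝ (deriv g) := hg1.differentiable (by norm_num)
  refine ⟨max C₁ C₂, hg.continuous.measurable, measurable_deriv g, hab,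
    fun x => (hC₁ x).trans (le_max_left _ _), fun x t => ?_, fun x t => ?_⟩
  · have h := convex_univ.norm_image_sub_le_of_norm_deriv_le (fun s _ => hd s)
      (fun s _ => hC₁ s) (mem_univ x) (mem_univ (x + t))
    rw [add_sub_cancel_left, Real.norm_eq_abs, Real.norm_eq_abs] at h
    exact h.trans (by gcongr; exact le_max_left _ _)
  · have hlip : ∀ s ∈ uIcc x (x + t), ‖deriv g s - deriv g x‖ ≤ max C₁ C₂ * |t| := by
      intro s hs
      refine (convex_univ.norm_image_sub_le_of_norm_deriv_le (fun s _ => hd1 s)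
        (fun s _ => hC₂ s) (mem_univ x) (mem_univ s)).trans ?_
      have := abs_sub_left_of_mem_uIcc hs
      rw [add_sub_cancel_left] at this
      rw [Real.norm_eq_abs]
      have := (norm_nonneg _).trans (hC₂ x)
      gcongr
      exact le_max_right _ _
    have h := (convex_uIcc x (x + t)).norm_image_sub_le_of_norm_hasDerivWithin_le
      (f := fun s => g s - s * deriv g x) (f' := fun s => deriv g s - deriv g x)
      (fun s _ => by
        have := (hd s).hasDerivAt.sub ((hasDerivAt_id s).mul_const (deriv g x))
        rw [one_mul] at this
        exact this.hasDerivWithinAt) hlip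
      left_mem_uIcc right_mem_uIcc
    rw [add_sub_cancel_left, Real.norm_eq_abs, Real.norm_eq_abs, mul_assoc, ← pow_two, sq_abs] at h
    refine le_trans (le_of_eq ?_) h
    congr 1
    ring

lemma exists_isSmoothBounded_approx {f : ℝ → ℝ} (hf : Measurable f)
    (hf' : ∀ x, f x ∈ Icc (0 : ℝ) 1) {ε : ℝ} (hε : 0 < ε) :
    ∃ a b L : ℝ, ∃ g g' : ℝ → ℝ, 0 < a ∧ b < 1 ∧ IsSmoothBounded a b L g g' ∧
      ∫ x, |f x - g x| ∂gam ≤ 4 * ε := by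
  have hfi : Integrable f gam := integrable_of_forall_mem_Icc hf hf'
  obtain ⟨u, hus, hu, huc, hui⟩ := hfi.exists_hasCompactSupport_integral_sub_le hε
  have hcc : Continuous fun x => max 0 (min 1 (u x)) := by fun_prop
  obtain ⟨v, hv, hvd, hvs⟩ := hcc.exists_contDiff_approx 2 (ε := fun _ => ε) continuous_const
    fun _ => hε
  have hvs' : HasCompactSupport v := hus.mono fun x hx => by
    have := hvs hx
    simp only [Function.mem_support] at this ⊢
    rintro h0
    simp [h0] at this
  have hvb : ∀ x, v x ∈ Icc (-ε) (1 + ε) := fun x => by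
    have h := abs_lt.1 (hvd x)
    have h1 : max 0 (min 1 (u x)) ≤ 1 := max_le zero_le_one (min_le_left _ _)
    have h2 : 0 ≤ max 0 (min 1 (u x)) := le_max_left _ _
    constructor <;> linarith [h.1, h.2]
  obtain ⟨L, hL⟩ := exists_isSmoothBounded_of_contDiff hv hvs' hvb
  have hD : 0 < 1 + 4 * ε := by positivity
  refine ⟨ε / (1 + 4 * ε), (1 + 3 * ε) / (1 + 4 * ε), L / (1 + 4 * ε),
    fun x => (v x + 2 * ε) / (1 + 4 * ε), fun x => deriv v x / (1 + 4 * ε), by positivity,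
    (div_lt_one hD).2 (by linarith), ⟨(hL.measurable.add_const _).div_const _,
      hL.measurable'.div_const _, fun x => ?_, fun x => ?_, fun x t => ?_, fun x t => ?_⟩, ?_⟩
  · have := hvb x
    constructor
    · exact div_le_div_of_nonneg_right (by linarith [this.1]) hD.le
    · exact div_le_div_of_nonneg_right (by linarith [this.2]) hD.le
  · rw [abs_div, abs_of_pos hD]
    gcongr
    exact hL.deriv_le x
  · rw [← sub_div, add_sub_add_right_eq_sub, abs_div, abs_of_pos hD, div_mul_eq_mul_div]
    gcongr
    exact hL.lipschitz x t
  · rw [← sub_div, add_sub_add_right_eq_sub, mul_div_assoc', ← sub_div, abs_div, abs_of_pos hD,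
      div_mul_eq_mul_div]
    gcongr
    exact hL.taylor x t
  · have hi1 : Integrable (fun x => |f x - u x|) gam := (hfi.sub hui).abs
    have hpt : ∀ x, |f x - (v x + 2 * ε) / (1 + 4 * ε)| ≤ |f x - u x| + 3 * ε := by
      intro x
      have e1 : |f x - max 0 (min 1 (u x))| ≤ |f x - u x| := by
        have hfx : max 0 (min 1 (f x)) = f x := by
          rw [min_eq_right (hf' x).2, max_eq_right (hf' x).1]
        nth_rewrite 1 [← hfx]
        refine (abs_max_sub_max_le_max _ _ _ _).trans (max_le (by simp) ?_)
        exact (abs_min_sub_min_le_max _ _ _ _).trans (max_le (by simp) le_rfl)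
      have e2 := hvd x
      rw [Real.dist_eq, abs_sub_comm] at e2
      have e3 : |v x - (v x + 2 * ε) / (1 + 4 * ε)| ≤ 2 * ε := by
        have : v x - (v x + 2 * ε) / (1 + 4 * ε) = (4 * ε * v x - 2 * ε) / (1 + 4 * ε) := by
          field_simp
          ring
        rw [this, abs_div, abs_of_pos hD, div_le_iff₀ hD, abs_le]
        have := hvb x
        constructor <;> nlinarith [this.1, this.2]
      have e4 := abs_sub_le (f x) (max 0 (min 1 (u x))) (v x)
      have e5 := abs_sub_le (f x) (v x) ((v x + 2 * ε) / (1 + 4 * ε))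
      linarith
    have hi2 : Integrable (fun x => f x - (v x + 2 * ε) / (1 + 4 * ε)) gam :=
      hfi.sub (((integrable_of_forall_mem_Icc hL.measurable hvb).add
        (integrable_const _)).div_const _)
    refine (integral_mono hi2.abs (hi1.add (integrable_const _)) hpt).trans ?_
    rw [integral_add' hi1 (integrable_const _)]
    simp only [Real.norm_eq_abs] at hu
    simp only [integral_const, probReal_univ, one_smul]
    linarith

lemma integral_comp_fst_biGaussian (h0 : 0 < ρ) (h1 : ρ < 1) {F : ℝ → ℝ} (hF : Measurable F) :
    ∫ p, F p.1 ∂(biGaussian ρ) = ∫ x, F x ∂gam := by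
  rw [← map_fst_biGaussian h0 h1,
    integral_map measurable_fst.aemeasurable hF.aestronglyMeasurable]

lemma integral_comp_snd_biGaussian (h0 : 0 < ρ) (h1 : ρ < 1) {F : ℝ → ℝ} (hF : Measurable F) :
    ∫ p, F p.2 ∂(biGaussian ρ) = ∫ x, F x ∂gam := by
  rw [← map_snd_biGaussian h0 h1,
    integral_map measurable_snd.aemeasurable hF.aestronglyMeasurable]

/-- The one-dimensional case of Borell's inequality. -/
lemma borell_dim_one (h0 : 0 < ρ) (h1 : ρ < 1) {f g : ℝ → ℝ} (hf : Measurable f)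
    (hg : Measurable g) (hf' : ∀ x, f x ∈ Icc (0 : ℝ) 1) (hg' : ∀ x, g x ∈ Icc (0 : ℝ) 1) :
    ∫ p, J ρ (f p.1) (g p.2) ∂(biGaussian ρ)
      ≤ J ρ (∫ p, f p.1 ∂(biGaussian ρ)) (∫ p, g p.2 ∂(biGaussian ρ)) := by
  have := isProbabilityMeasure_biGaussian h0 h1
  refine le_of_forall_pos_le_add fun δ hδ => ?_
  obtain ⟨a, b, L, u, u', ha, hb, hu, hfu⟩ :=
    exists_isSmoothBounded_approx hf hf' (show 0 < δ / 16 by positivity)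
  obtain ⟨a₁, b₁, L₁, v, v', ha₁, hb₁, hv, hgv⟩ :=
    exists_isSmoothBounded_approx hg hg' (show 0 < δ / 16 by positivity)
  have hsm := borell_of_isSmoothBounded h0 h1 (lt_min ha ha₁) (max_lt hb hb₁)
    (hu.mono (min_le_left _ a₁) (le_max_left _ b₁) (le_max_left _ L₁))
    (hv.mono (min_le_right a _) (le_max_right b _) (le_max_right L _))
  have hu' : ∀ x, u x ∈ Icc (0 : ℝ) 1 := fun x => Icc_subset_Icc ha.le hb.le (hu.mem_Icc x)
  have hv' : ∀ x, v x ∈ Icc (0 : ℝ) 1 := fun x => Icc_subset_Icc ha₁.le hb₁.le (hv.mem_Icc x)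
  have hi : ∀ {F : ℝ → ℝ}, Measurable F → (∀ x, F x ∈ Icc (0 : ℝ) 1) → Integrable F gam :=
    fun hF hF' => integrable_of_forall_mem_Icc hF hF'
  have hfst : ∀ {F : ℝ → ℝ}, Measurable F → (∀ x, F x ∈ Icc (0 : ℝ) 1) →
      Integrable (fun p : ℝ × ℝ => F p.1) (biGaussian ρ) :=
    fun hF hF' => integrable_of_forall_mem_Icc (hF.comp measurable_fst) fun p => hF' p.1
  have hsnd : ∀ {F : ℝ → ℝ}, Measurable F → (∀ x, F x ∈ Icc (0 : ℝ) 1) →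
      Integrable (fun p : ℝ × ℝ => F p.2) (biGaussian ρ) :=
    fun hF hF' => integrable_of_forall_mem_Icc (hF.comp measurable_snd) fun p => hF' p.2
  have i1 : Integrable (fun p : ℝ × ℝ => |f p.1 - u p.1|) (biGaussian ρ) :=
    ((hfst hf hf').sub (hfst hu.measurable hu')).abs
  have i2 : Integrable (fun p : ℝ × ℝ => |g p.2 - v p.2|) (biGaussian ρ) :=
    ((hsnd hg hg').sub (hsnd hv.measurable hv')).abs
  have i3 : Integrable (fun p : ℝ × ℝ => J ρ (u p.1) (v p.2)) (biGaussian ρ) :=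
    integrable_J_comp h0 h1 (hu.measurable.comp measurable_fst) (hv.measurable.comp measurable_snd)
      (fun p => hu' _) fun p => hv' _
  have i4 : Integrable (fun p : ℝ × ℝ => J ρ (f p.1) (g p.2)) (biGaussian ρ) :=
    integrable_J_comp h0 h1 (hf.comp measurable_fst) (hg.comp measurable_snd)
      (fun p => hf' _) fun p => hg' _
  have hle := integral_mono i4 (i3.add (i1.add i2)) fun p =>
    J_le_add h0 h1 (hu' p.1) (hf' p.1) (hv' p.2) (hg' p.2)
  rw [integral_add' i3 (i1.add i2), integral_add' i1 i2,
    integral_comp_fst_biGaussian h0 h1 (F := fun x => |f x - u x|)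
      (hf.sub hu.measurable).abs,
    integral_comp_snd_biGaussian h0 h1 (F := fun x => |g x - v x|)
      (hg.sub hv.measurable).abs] at hle
  rw [integral_comp_fst_biGaussian h0 h1 hu.measurable,
    integral_comp_snd_biGaussian h0 h1 hv.measurable] at hsm
  rw [integral_comp_fst_biGaussian h0 h1 hf, integral_comp_snd_biGaussian h0 h1 hg]
  have hJ := J_le_add h0 h1 (integral_mem_Icc (hi hf hf') hf')
    (integral_mem_Icc (hi hu.measurable hu') hu') (integral_mem_Icc (hi hg hg') hg')
    (integral_mem_Icc (hi hv.measurable hv') hv')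
  have k1 : |(∫ x, u x ∂gam) - ∫ x, f x ∂gam| ≤ ∫ x, |f x - u x| ∂gam := by
    rw [abs_sub_comm, ← integral_sub (hi hf hf') (hi hu.measurable hu')]
    exact abs_integral_le_integral_abs
  have k2 : |(∫ x, v x ∂gam) - ∫ x, g x ∂gam| ≤ ∫ x, |g x - v x| ∂gam := by
    rw [abs_sub_comm, ← integral_sub (hi hg hg') (hi hv.measurable hv')]
    exact abs_integral_le_integral_abs
  linarith

/-- Fubini's theorem separating the first of `d + 1` independent coordinates. -/
lemma integral_pi_succ {E : Type*} [MeasurableSpace E] (P : Measure E) [IsProbabilityMeasure P]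
    {d : ℕ} {F : (Fin (d + 1) → E) → ℝ} (hF : Measurable F) (hF' : ∀ ω, F ω ∈ Icc (0 : ℝ) 1) :
    ∫ ω, F ω ∂(Measure.pi fun _ => P)
      = ∫ η, ∫ p, F (Fin.cons p η) ∂P ∂(Measure.pi fun _ : Fin d => P) := by
  have hmp := (measurePreserving_piFinSuccAbove (fun _ : Fin (d + 1) => P) 0).symm
  have hi : Integrable (fun z => F ((MeasurableEquiv.piFinSuccAbove (fun _ => E) 0).symm z))
      (P.prod (Measure.pi fun _ : Fin d => P)) :=
    integrable_of_forall_mem_Icc (hF.comp (MeasurableEquiv.measurable _)) fun z => hF' _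
  rw [← hmp.integral_comp' (g := F), integral_prod_symm _ hi]
  have hcons : ∀ (p : E) (η : Fin d → E),
      (MeasurableEquiv.piFinSuccAbove (fun _ => E) 0).symm (p, η) = Fin.cons p η := fun p η => by
    rw [← Fin.insertNth_zero']
    rfl
  simp only [hcons]

lemma comp_cons {α β : Type*} (φ : α → β) {d : ℕ} (p : α) (η : Fin d → α) :
    (fun i => φ ((Fin.cons p η : Fin (d + 1) → α) i))
      = (Fin.cons (φ p) fun i => φ (η i) : Fin (d + 1) → β) := by
  ext i
  refine Fin.cases ?_ (fun j => ?_) i <;> simp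

lemma measurable_cons {α : Type*} [MeasurableSpace α] (d : ℕ) :
    Measurable fun z : α × (Fin d → α) => (Fin.cons z.1 z.2 : Fin (d + 1) → α) := by
  refine measurable_pi_lambda _ fun i => ?_
  refine Fin.cases ?_ (fun j => ?_) i
  · simpa using measurable_fst
  · simp only [Fin.cons_succ]
    fun_prop

end

/-- **Borell's functional inequality** (Theorem 4.1). The pair `(G₁, G₂)` of jointly
Gaussian standard vectors with `Cov((G₁)_i, (G₂)_j) = ρ δ_{ij}` is realized as
`ω ↦ ((ω i).1)_i, ((ω i).2)_i` with `ω` distributed according to the product of `d`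
independent copies of the `ρ`-correlated bivariate Gaussian. -/
theorem borell_inequality (ρ : ℝ) (hρ0 : 0 < ρ) (hρ1 : ρ < 1) (d : ℕ)
    (f₁ f₂ : (Fin d → ℝ) → ℝ) (hf₁ : Measurable f₁) (hf₂ : Measurable f₂)
    (hr₁ : ∀ z, f₁ z ∈ Set.Icc (0 : ℝ) 1) (hr₂ : ∀ z, f₂ z ∈ Set.Icc (0 : ℝ) 1) :
    (∫ ω : Fin d → ℝ × ℝ,
        J ρ (f₁ fun i => (ω i).1) (f₂ fun i => (ω i).2)
        ∂(Measure.pi fun _ => biGaussian ρ)) ≤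
      J ρ (∫ ω : Fin d → ℝ × ℝ, f₁ (fun i => (ω i).1) ∂(Measure.pi fun _ => biGaussian ρ))
          (∫ ω : Fin d → ℝ × ℝ, f₂ (fun i => (ω i).2) ∂(Measure.pi fun _ => biGaussian ρ)) := by

  have := isProbabilityMeasure_biGaussian hρ0 hρ1
  induction d with
  | zero =>
    have h₁ : ∀ z, f₁ z = f₁ 0 := fun z => by rw [Subsingleton.elim z 0]
    have h₂ : ∀ z, f₂ z = f₂ 0 := fun z => by rw [Subsingleton.elim z 0]
    simp only [h₁, h₂, integral_const, probReal_univ, one_smul, le_refl]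
  | succ d ih =>
    have hm₁ : ∀ d : ℕ, Measurable fun ω : Fin d → ℝ × ℝ => fun i => (ω i).1 := fun d => by
      fun_prop
    have hm₂ : ∀ d : ℕ, Measurable fun ω : Fin d → ℝ × ℝ => fun i => (ω i).2 := fun d => by
      fun_prop
    have hJm : Measurable fun ω : Fin (d + 1) → ℝ × ℝ =>
        J ρ (f₁ fun i => (ω i).1) (f₂ fun i => (ω i).2) :=
      measurable_J_comp hρ0 hρ1 (hf₁.comp (hm₁ _)) (hf₂.comp (hm₂ _)) (fun ω => hr₁ _)
        fun ω => hr₂ _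
    have hJ : ∀ ω : Fin (d + 1) → ℝ × ℝ,
        J ρ (f₁ fun i => (ω i).1) (f₂ fun i => (ω i).2) ∈ Set.Icc (0 : ℝ) 1 := fun ω =>
      ⟨J_nonneg hρ0 hρ1 (hr₁ _) (hr₂ _), J_le_one hρ0 hρ1 (hr₁ _) (hr₂ _)⟩
    let g₁ : (Fin d → ℝ) → ℝ := fun w => ∫ p, f₁ (Fin.cons p.1 w) ∂(biGaussian ρ)
    let g₂ : (Fin d → ℝ) → ℝ := fun w => ∫ p, f₂ (Fin.cons p.2 w) ∂(biGaussian ρ)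
    have hc₁ : Measurable fun q : (Fin d → ℝ) × (ℝ × ℝ) =>
        (Fin.cons q.2.1 q.1 : Fin (d + 1) → ℝ) :=
      (measurable_cons d).comp ((measurable_fst.comp measurable_snd).prodMk measurable_fst)
    have hc₂ : Measurable fun q : (Fin d → ℝ) × (ℝ × ℝ) =>
        (Fin.cons q.2.2 q.1 : Fin (d + 1) → ℝ) :=
      (measurable_cons d).comp ((measurable_snd.comp measurable_snd).prodMk measurable_fst)
    have hg₁ : Measurable g₁ := (hf₁.comp hc₁).stronglyMeasurable.integral_prod_right'.measurable
    have hg₂ : Measurable g₂ := (hf₂.comp hc₂).stronglyMeasurable.integral_prod_right'.measurable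
    have hs₁ : ∀ w : Fin d → ℝ, Measurable fun x : ℝ => f₁ (Fin.cons x w) := fun w =>
      hf₁.comp ((measurable_cons d).comp (measurable_id.prodMk measurable_const))
    have hs₂ : ∀ w : Fin d → ℝ, Measurable fun x : ℝ => f₂ (Fin.cons x w) := fun w =>
      hf₂.comp ((measurable_cons d).comp (measurable_id.prodMk measurable_const))
    have hgr₁ : ∀ w, g₁ w ∈ Set.Icc (0 : ℝ) 1 := fun w => integral_mem_Icc
      (integrable_of_forall_mem_Icc ((hs₁ w).comp measurable_fst) fun p => hr₁ _) fun p => hr₁ _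
    have hgr₂ : ∀ w, g₂ w ∈ Set.Icc (0 : ℝ) 1 := fun w => integral_mem_Icc
      (integrable_of_forall_mem_Icc ((hs₂ w).comp measurable_snd) fun p => hr₂ _) fun p => hr₂ _
    have hind := ih g₁ g₂ hg₁ hg₂ hgr₁ hgr₂
    have e₀ := integral_pi_succ (biGaussian ρ) hJm hJ
    have e₁ := integral_pi_succ (biGaussian ρ) (hf₁.comp (hm₁ _)) fun ω => hr₁ _
    have e₂ := integral_pi_succ (biGaussian ρ) (hf₂.comp (hm₂ _)) fun ω => hr₂ _
    simp only [Function.comp_def, comp_cons Prod.fst, comp_cons Prod.snd] at e₀ e₁ e₂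
    rw [e₀, e₁, e₂]
    refine le_trans (integral_mono ?_ ?_ fun η => ?_) hind
    · have hm : Measurable fun q : (Fin d → ℝ × ℝ) × (ℝ × ℝ) =>
          J ρ (f₁ (Fin.cons q.2.1 fun i => (q.1 i).1)) (f₂ (Fin.cons q.2.2 fun i => (q.1 i).2)) :=
        measurable_J_comp hρ0 hρ1
          (hf₁.comp (hc₁.comp (((hm₁ d).comp measurable_fst).prodMk measurable_snd)))
          (hf₂.comp (hc₂.comp (((hm₂ d).comp measurable_fst).prodMk measurable_snd)))
          (fun _ => hr₁ _) fun _ => hr₂ _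
      exact (integrable_of_forall_mem_Icc (a := 0) (b := 1) hm fun q =>
        ⟨J_nonneg hρ0 hρ1 (hr₁ _) (hr₂ _), J_le_one hρ0 hρ1 (hr₁ _) (hr₂ _)⟩).integral_prod_left
    · exact integrable_J_comp hρ0 hρ1 (hg₁.comp (hm₁ d)) (hg₂.comp (hm₂ d)) (fun _ => hgr₁ _)
        fun _ => hgr₂ _
    · exact borell_dim_one hρ0 hρ1 (hs₁ _) (hs₂ _) (fun _ => hr₁ _) fun _ => hr₂ _

end DMN
end
end

section
/- (Claim 4.2) Let f : {−1,1}ⁿ → ℝ, let X be uniform on {−1,1}ⁿ, and for i ∈ {1,…,n} let X^{−i} = (X₁,…,X_{i−1}, −X_i, X_{i+1},…,X_n). Then Δ_n(f) ≤ Σ_{i=1}^{n} E|f(X) − f(X^{−i})|³. -/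
noncomputable section
namespace DMN

/-- The real sign of a boolean bit: `true ↦ 1`, `false ↦ -1`. -/
def sgn (b : Bool) : ℝ := if b then 1 else -1

/-- The character `χ_S(x) = ∏_{i ∈ S} x_i` on the discrete cube. -/
def chi {n : ℕ} (S : Finset (Fin n)) (x : Fin n → Bool) : ℝ := ∏ i ∈ S, sgn (x i)

/-- Expectation over the uniform measure on `{-1,1}^n`. -/
def cubeE {n : ℕ} (f : (Fin n → Bool) → ℝ) : ℝ := (∑ x, f x) / 2 ^ n

/-- Fourier coefficient `f̂(S) = E[f · χ_S]`. -/
def fhat {n : ℕ} (f : (Fin n → Bool) → ℝ) (S : Finset (Fin n)) : ℝ :=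
  cubeE fun x => f x * chi S x

/-- `Δ₁(g) = E|g - E g|³` for `g : {-1,1} → ℝ` (uniform measure on one bit). -/
def Delta1Cube (g : Bool → ℝ) : ℝ :=
  (∑ b : Bool, |g b - (∑ b' : Bool, g b') / 2| ^ 3) / 2

/-- The recursively defined functional `Δ_n` on the discrete cube:
`Δ_n(f) = E_{X_n}[Δ_{n-1}(f_{X_n})] + Δ₁(E[f_{X_n} | X_n])`, with `Δ_0 = 0`. -/
def DeltaCube : (n : ℕ) → ((Fin n → Bool) → ℝ) → ℝ
  | 0, _ => 0
  | n + 1, f =>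
      (∑ b : Bool, DeltaCube n fun z => f (Fin.snoc z b)) / 2 +
        Delta1Cube fun b => cubeE fun z => f (Fin.snoc z b)

/-- Expectation over the cube, conditioning on the last coordinate. -/
theorem cubeE_succ {n : ℕ} (f : (Fin (n + 1) → Bool) → ℝ) :
    cubeE f = (∑ b : Bool, cubeE fun z => f (Fin.snoc z b)) / 2 := by
  have h : ∑ x, f x = ∑ b : Bool, ∑ z : Fin n → Bool, f (Fin.snoc z b) := by
    rw [← (Fin.snocEquiv fun _ : Fin (n + 1) => Bool).sum_comp, Fintype.sum_prod_type]
    rfl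
  simp only [cubeE, h, ← Finset.sum_div]
  rw [pow_succ, div_div]

/-- Jensen's inequality for `t ↦ |t| ^ 3` on the cube. -/
theorem abs_cubeE_pow_three_le {n : ℕ} (g : (Fin n → Bool) → ℝ) :
    |cubeE g| ^ 3 ≤ cubeE fun z => |g z| ^ 3 := by
  have hJ := pow_sum_div_card_le_sum_pow (s := Finset.univ) (f := fun z => |g z|)
    (fun z _ => abs_nonneg _) 2
  have hcard : ((Finset.univ : Finset (Fin n → Bool)).card : ℝ) = 2 ^ n := by simp
  rw [hcard] at hJ
  have hpos : (0 : ℝ) < 2 ^ n := by positivity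
  calc |cubeE g| ^ 3 = |∑ z, g z| ^ 3 / (2 ^ n) ^ 2 / 2 ^ n := by
        rw [cubeE, abs_div, abs_of_pos hpos]
        field_simp
    _ ≤ (∑ z, |g z|) ^ 3 / (2 ^ n) ^ 2 / 2 ^ n := by
        gcongr
        exact Finset.abs_sum_le_sum_abs _ _
    _ ≤ cubeE fun z => |g z| ^ 3 := by
        rw [cubeE]
        gcongr

theorem cubeE_sub {n : ℕ} (f g : (Fin n → Bool) → ℝ) :
    cubeE f - cubeE g = cubeE fun z => f z - g z := by
  simp only [cubeE, Finset.sum_sub_distrib, sub_div]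

theorem Delta1Cube_le (g : Bool → ℝ) : Delta1Cube g ≤ |g true - g false| ^ 3 := by
  have h₁ : g true - (g true + g false) / 2 = (g true - g false) / 2 := by ring
  have h₂ : g false - (g true + g false) / 2 = -((g true - g false) / 2) := by ring
  have h := pow_nonneg (abs_nonneg (g true - g false)) 3
  simp only [Delta1Cube, Fintype.sum_bool, h₁, h₂, abs_neg, abs_div, abs_two, div_pow]
  linarith

/-- **Claim 4.2**: `Δ_n(f) ≤ Σ_i E|f(X) - f(X^{-i})|³`, where `X^{-i}` flips the `i`-th
coordinate of `X`. -/
theorem DeltaCube_le (n : ℕ) (f : (Fin n → Bool) → ℝ) :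
    DeltaCube n f ≤
      ∑ i : Fin n, cubeE fun X => |f X - f (Function.update X i (!(X i)))| ^ 3 := by
  induction n with
  | zero => simp [DeltaCube]
  | succ n ih =>
    rw [DeltaCube, Fin.sum_univ_castSucc]
    refine add_le_add ?_ ?_
    · simp_rw [cubeE_succ, ← Finset.sum_div]
      rw [Finset.sum_comm]
      gcongr with b
      simpa [Fin.snoc_update] using ih fun z => f (Fin.snoc z b)
    · refine (Delta1Cube_le _).trans ?_
      rw [cubeE_sub]
      refine (abs_cubeE_pow_three_le _).trans_eq ?_
      rw [cubeE_succ]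
      simp [Fin.update_snoc_last, abs_sub_comm (f (Fin.snoc _ false))]

end DMN
end
end
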